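/- Let γ: ℝ/L → ℝ³ be a minimal inspection curve with unfolding γ̃: [0, L] → ℝ². Then γ̃ is locally one-to-one: every t ∈ [0, L] has a neighborhood in [0, L] on which γ̃ is injective. -/

import Mathlib

open Real Set MeasureTheory ENNReal

noncomputable section


noncomputable section

abbrev E3 := EuclideanSpace ℝ (Fin 3)

/-- The lift of a curve `γ : ℝ/L → ℝ³` to `ℝ`, via the quotient map `ℝ → ℝ/L`. -/
def liftCurve (L : ℝ) (γ : AddCircle L → E3) : ℝ → E3 := fun s => γ s

/-- An inspection curve is a closed rectifiable curve `γ : ℝ/L → ℝ³`, parameterized with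
constant unit speed (`1`-Lipschitz with total variation `L` over one period), whose convex
hull contains the unit sphere centered at the origin. -/
def IsInspectionCurve (L : ℝ) (γ : AddCircle L → E3) : Prop :=
  0 < L ∧ Continuous γ ∧ LipschitzWith 1 (liftCurve L γ) ∧
    eVariationOn (liftCurve L γ) (Set.Icc 0 L) = ENNReal.ofReal L ∧
    Metric.sphere (0 : E3) 1 ⊆ convexHull ℝ (Set.range γ)

/-- A minimal inspection curve is an inspection curve of minimal length. -/
def IsMinInspectionCurve (L : ℝ) (γ : AddCircle L → E3) : Prop :=
  IsInspectionCurve L γ ∧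
    ∀ (L' : ℝ) (γ' : AddCircle L' → E3), IsInspectionCurve L' γ' → L ≤ L'

/-- The (almost-everywhere defined) derivative of the radial projection
`γ̄ = γ/|γ| : ℝ → S²` of the lifted curve. -/
def projDeriv (L : ℝ) (γ : AddCircle L → E3) : ℝ → E3 :=
  deriv fun s : ℝ => ‖liftCurve L γ s‖⁻¹ • liftCurve L γ s

/-- The arclength function `θ(t) = ∫₀ᵗ |γ̄'(s)| ds` of the radial projection of `γ`. -/
def thetaFn (L : ℝ) (γ : AddCircle L → E3) (t : ℝ) : ℝ :=
  ∫ u in (0:ℝ)..t, ‖projDeriv L γ u‖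

/-- `γt : [0,L] → ℝ² ≅ ℂ` is the unfolding of `γ : ℝ/L → ℝ³`: for the finitely many times
`0 = t₀ < t₁ < ⋯ < t_m = L` at which `γ` passes through the origin (together with the
distinguished endpoints `0` and `L`), one has
`γt(s) = |γ(s)| · e^{i(θ(s) + (k-1)π)}` for `s ∈ [t_{k-1}, t_k]`. -/
def IsUnfolding (L : ℝ) (γ : AddCircle L → E3) (γt : ℝ → ℂ) : Prop :=
  ∃ (m : ℕ) (tk : ℕ → ℝ), 0 < m ∧ StrictMonoOn tk (Set.Iic m) ∧
    tk 0 = 0 ∧ tk m = L ∧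
    (∀ s ∈ Set.Ioo (0:ℝ) L,
      (liftCurve L γ s = 0 ↔ ∃ k : ℕ, 0 < k ∧ k < m ∧ s = tk k)) ∧
    (∀ k : ℕ, 1 ≤ k → k ≤ m → ∀ s ∈ Set.Icc (tk (k-1)) (tk k),
      γt s = (‖liftCurve L γ s‖ : ℂ) *
        Complex.exp (Complex.I * Complex.ofReal (thetaFn L γ s + ((k : ℝ) - 1) * π)))

/-- In `ℝ³`, the convex hull of a compact set is compact. -/
lemma isCompact_convexHull_E3 {C : Set E3} (hC : IsCompact C) : IsCompact (convexHull ℝ C) := by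
  have hK : IsCompact ((stdSimplex ℝ (Fin 4)) ×ˢ (Set.pi univ fun _ : Fin 4 => C)) :=
    (isCompact_stdSimplex ℝ (Fin 4)).prod (isCompact_univ_pi fun _ => hC)
  have hcont : Continuous fun wz : (Fin 4 → ℝ) × (Fin 4 → E3) => ∑ i, wz.1 i • wz.2 i := by
    fun_prop
  convert hK.image hcont
  refine Subset.antisymm (fun x hx => ?_) ?_
  · obtain ⟨ι, _, z, w, hz, hind, hw, hw1, hx⟩ := eq_pos_convex_span_of_mem_convexHull hx
    have hcard : Fintype.card ι ≤ 4 := by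
      have h1 := hind.card_le_finrank_succ
      have h2 := Submodule.finrank_le (vectorSpan ℝ (range z))
      rw [finrank_euclideanSpace, Fintype.card_fin] at h2
      omega
    obtain ⟨e⟩ : Nonempty (ι ↪ Fin 4) :=
      Function.Embedding.nonempty_of_card_le (by simpa using hcard)
    have hne : Nonempty ι := by
      by_contra h
      rw [not_nonempty_iff] at h
      simp at hw1
    obtain ⟨i₀⟩ := hne
    let W : Fin 4 → ℝ := Function.extend e w 0
    let Z : Fin 4 → E3 := Function.extend e z fun _ => z i₀
    have key : ∀ {M : Type} [AddCommMonoid M] (F : Fin 4 → M),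
        (∀ j, j ∉ range e → F j = 0) → ∑ j, F j = ∑ i, F (e i) := by
      intro M _ F hF
      rw [← Finset.sum_map Finset.univ e F]
      symm
      apply Finset.sum_subset (Finset.subset_univ _)
      intro j _ hj
      apply hF
      simpa using hj
    have hW0 : ∀ j, j ∉ range e → W j = 0 := fun j hj =>
      Function.extend_apply' _ _ _ (by simpa using hj)
    have hWe : ∀ i, W (e i) = w i := fun i => e.injective.extend_apply _ _ _
    have hZe : ∀ i, Z (e i) = z i := fun i => e.injective.extend_apply _ _ _
    refine ⟨(W, Z), ⟨⟨fun j => ?_, ?_⟩, fun j _ => ?_⟩, ?_⟩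
    · by_cases hj : j ∈ range e
      · obtain ⟨i, rfl⟩ := hj
        change 0 ≤ W (e i)
        exact (hw i).le.trans_eq (hWe i).symm
      · exact (hW0 j hj).ge
    · change ∑ j, W j = 1
      rw [key W hW0]
      simpa [hWe] using hw1
    · by_cases hj : j ∈ range e
      · obtain ⟨i, rfl⟩ := hj
        change Z (e i) ∈ C
        exact hZe i ▸ hz (mem_range_self i)
      · have : Z j = z i₀ := Function.extend_apply' _ _ _ (by simpa using hj)
        change Z j ∈ C
        exact this ▸ hz (mem_range_self i₀)
    · change ∑ j, W j • Z j = x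
      rw [key (fun j => W j • Z j) (fun j hj => by simp [hW0 j hj])]
      simpa [hWe, hZe] using hx
  · rintro _ ⟨⟨w, z⟩, ⟨⟨hw, hw1⟩, hz⟩, rfl⟩
    exact (convex_convexHull ℝ C).sum_mem (fun i _ => hw i) hw1
      fun i _ => subset_convexHull ℝ C (hz i (mem_univ i))

/-- A set `C` inspects the unit sphere if every half-space containing `C` has support number at
least `1`; for compact `C` this says that the unit ball lies in the convex hull of `C`. -/
def Inspects (C : Set E3) : Prop := ∀ v : E3, ∃ p ∈ C, ‖v‖ ≤ inner ℝ p v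

lemma Inspects.mono {C D : Set E3} (h : Inspects C) (hCD : C ⊆ D) : Inspects D := fun v =>
  let ⟨p, hp, hv⟩ := h v
  ⟨p, hCD hp, hv⟩

lemma Inspects.sphere_subset {C : Set E3} (hC : IsCompact C) (h : Inspects C) :
    Metric.sphere (0 : E3) 1 ⊆ convexHull ℝ C := by
  intro x hx
  by_contra hxC
  obtain ⟨f, u, hf, hu⟩ := geometric_hahn_banach_closed_point (convex_convexHull ℝ C)
    (isCompact_convexHull_E3 hC).isClosed hxC
  obtain ⟨p, hp, hv⟩ := h ((InnerProductSpace.toDual ℝ E3).symm f)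
  have h1 := hf p (subset_convexHull ℝ C hp)
  have h2 : f x ≤ ‖(InnerProductSpace.toDual ℝ E3).symm f‖ := by
    rw [LinearIsometryEquiv.norm_map]
    have := f.le_opNorm x
    rw [mem_sphere_zero_iff_norm.1 hx, mul_one] at this
    exact (le_abs_self _).trans this
  rw [real_inner_comm, InnerProductSpace.toDual_symm_apply] at hv
  linarith

lemma inspects_of_sphere_subset {C : Set E3} (h : Metric.sphere (0 : E3) 1 ⊆ convexHull ℝ C) :
    Inspects C := by
  have hne : C.Nonempty := by
    rw [← convexHull_nonempty_iff (𝕜 := ℝ)]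
    exact ⟨_, h (mem_sphere_zero_iff_norm.2
      (by simp : ‖EuclideanSpace.single (0 : Fin 3) (1 : ℝ)‖ = 1))⟩
  intro v
  rcases eq_or_ne v 0 with rfl | hv
  · obtain ⟨p, hp⟩ := hne
    exact ⟨p, hp, by simp⟩
  by_contra! hlt
  have hsub : convexHull ℝ C ⊆ {p | inner ℝ p v < ‖v‖} := by
    refine convexHull_min hlt ?_
    have := convex_halfSpace_lt (𝕜 := ℝ) (f := fun p : E3 => inner ℝ p v)
      ⟨fun x y => inner_add_left x y v, fun c x => by simp [inner_smul_left]⟩ ‖v‖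
    exact this
  have hv' : ‖v‖ ≠ 0 := norm_ne_zero_iff.2 hv
  have hu : ‖v‖⁻¹ • v ∈ Metric.sphere (0 : E3) 1 := by
    simp [norm_smul, hv']
  have := hsub (h hu)
  simp only [mem_ofPred_eq, inner_smul_left, real_inner_self_eq_norm_sq, conj_trivial] at this
  rw [pow_two, inv_mul_cancel_left₀ hv'] at this
  exact lt_irrefl _ this

lemma lipschitzOnWith_one_of_le {α : Type*} [PseudoMetricSpace α] {f : ℝ → α} {s : Set ℝ}
    (h : ∀ x ∈ s, ∀ y ∈ s, x ≤ y → dist (f x) (f y) ≤ y - x) : LipschitzOnWith 1 f s := by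
  refine LipschitzOnWith.of_dist_le_mul fun x hx y hy => ?_
  simp only [NNReal.coe_one, one_mul]
  rcases le_total x y with hxy | hxy
  · rw [Real.dist_eq, abs_sub_comm, abs_of_nonneg (by linarith)]
    exact h x hx y hy hxy
  · rw [Real.dist_eq, abs_of_nonneg (by linarith), dist_comm]
    exact h y hy x hx hxy

/-- Closing up a `1`-Lipschitz loop gives a `1`-Lipschitz periodic curve. -/
lemma lipschitzWith_liftIco {V : ℝ} [hV : Fact (0 < V)] {N : ℝ → E3}
    (hN : LipschitzOnWith 1 N (Icc 0 V)) (h0 : N 0 = N V) :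
    LipschitzWith 1 (liftCurve V (AddCircle.liftIco V 0 N)) := by
  have hVpos : 0 < V := hV.out
  set F := liftCurve V (AddCircle.liftIco V 0 N) with hF
  have hper : ∀ (n : ℤ) s, F (s + n * V) = F s := by
    intro n s
    have : ((s + n * V : ℝ) : AddCircle V) = (s : AddCircle V) := by
      rw [← zsmul_eq_mul, AddCircle.coe_add, AddCircle.coe_zsmul, AddCircle.coe_period, smul_zero,
        add_zero]
    simp only [hF, liftCurve, this]
  have hcell : ∀ s ∈ Icc 0 V, F s = N s := by
    intro s hs
    rcases eq_or_lt_of_le hs.2 with rfl | h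
    · have h1 := hper 1 0
      have h2 : F 0 = N 0 := AddCircle.liftIco_zero_coe_apply ⟨le_rfl, hVpos⟩
      simp only [Int.cast_one, one_mul, zero_add] at h1
      rw [h1, h2, h0]
    · exact AddCircle.liftIco_zero_coe_apply ⟨hs.1, h⟩
  have hloc : ∀ (n : ℤ) x y, n * V ≤ x → x ≤ y → y ≤ (n + 1) * V → dist (F x) (F y) ≤ y - x := by
    intro n x y h1 h2 h3
    have hx : F x = N (x - n * V) := by
      rw [← hcell _ ⟨by linarith, by linarith⟩, ← hper n (x - n * V), sub_add_cancel]
    have hy : F y = N (y - n * V) := by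
      rw [← hcell _ ⟨by linarith, by linarith⟩, ← hper n (y - n * V), sub_add_cancel]
    rw [hx, hy]
    have := hN.dist_le_mul (x - n * V) ⟨by linarith, by linarith⟩ (y - n * V)
      ⟨by linarith, by linarith⟩
    rw [Real.dist_eq, abs_sub_comm] at this
    rw [abs_of_nonneg (by linarith)] at this
    simpa using this
  have hle : ∀ x y, x ≤ y → dist (F x) (F y) ≤ y - x := by
    intro x y hxy
    set n := ⌊x / V⌋
    set k := ⌊y / V⌋
    have hn1 : n * V ≤ x := (le_div_iff₀ hVpos).1 (Int.floor_le _)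
    have hn2 : x < (n + 1) * V := (div_lt_iff₀ hVpos).1 (Int.lt_floor_add_one _)
    have hk1 : k * V ≤ y := (le_div_iff₀ hVpos).1 (Int.floor_le _)
    have hk2 : y < (k + 1) * V := (div_lt_iff₀ hVpos).1 (Int.lt_floor_add_one _)
    rcases le_or_gt y ((n + 1) * V) with h | h
    · exact hloc n x y hn1 hxy h
    · have hnk : n + 1 ≤ k := Int.le_floor.2 ((le_div_iff₀ hVpos).2 (by push_cast; exact h.le))
      have hnk' : (n + 1 : ℝ) * V ≤ k * V :=
        mul_le_mul_of_nonneg_right (by exact_mod_cast hnk) hVpos.le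
      have e1 : F ((n + 1) * V) = F (k * V) := by
        have a1 := hper (n + 1) 0
        have a2 := hper k 0
        push_cast at a1
        rw [zero_add] at a1 a2
        rw [a1, a2]
      have d1 := hloc n x ((n + 1) * V) hn1 hn2.le le_rfl
      have d2 := hloc k (k * V) y le_rfl hk1 hk2.le
      have d3 := dist_triangle (F x) (F (k * V)) (F y)
      rw [← e1] at d3 d2
      linarith
  exact lipschitzOnWith_univ.1 (lipschitzOnWith_one_of_le fun x _ y _ => hle x y)

/-- A `1`-Lipschitz loop defined on `[0, ℓ]` whose image inspects the sphere is at least as long as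
a minimal inspection curve. -/
lemma IsMinInspectionCurve.le_of_loop {L : ℝ} {γ : AddCircle L → E3}
    (hγ : IsMinInspectionCurve L γ) {ℓ : ℝ} (hℓ : 0 ≤ ℓ) {f : ℝ → E3}
    (hf : LipschitzOnWith 1 f (Icc 0 ℓ)) (hf0 : f 0 = f ℓ) (hi : Inspects (f '' Icc 0 ℓ)) :
    L ≤ ℓ := by
  set s := Icc 0 ℓ with hs
  have h0s : (0 : ℝ) ∈ s := ⟨le_rfl, hℓ⟩
  have hℓs : ℓ ∈ s := ⟨hℓ, le_rfl⟩
  have hbv : LocallyBoundedVariationOn f s := hf.locallyBoundedVariationOn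
  set φ := variationOnFromTo f s 0 with hφ
  set N := naturalParameterization f s 0 with hN
  have hNφ : ∀ b ∈ s, N (φ b) = f b := fun b hb =>
    edist_eq_zero.1 (edist_naturalParameterization_eq_zero hbv h0s hb)
  have hφ0 : φ 0 = 0 := variationOnFromTo.self f s 0
  have hφmono : MonotoneOn φ s := variationOnFromTo.monotoneOn hbv h0s
  have hφlip : ∀ x ∈ s, ∀ y ∈ s, x ≤ y → φ y - φ x ≤ y - x := by
    intro x hx y hy hxy
    have hadd := variationOnFromTo.add hbv h0s hx hy
    have : φ y - φ x = variationOnFromTo f s x y := by simp only [hφ]; linarith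
    rw [this, variationOnFromTo.eq_of_le f s hxy]
    refine ENNReal.toReal_le_of_le_ofReal (by linarith) ?_
    have h1 := hf.comp_eVariationOn_le (g := id) (s := s ∩ Icc x y) (fun t ht => ht.1)
    have h2 := (monotone_id (α := ℝ).monotoneOn (s := s ∩ Icc x y)).eVariationOn_eq
      (a := x) (b := y) ⟨hx, left_mem_Icc.2 hxy⟩ ⟨hy, right_mem_Icc.2 hxy⟩
    simp only [Function.comp_id, ENNReal.coe_one, one_mul, id] at h1 h2
    refine h1.trans (le_trans ?_ h2.le)
    exact eVariationOn.mono _ fun t ht => ⟨ht, ht.2⟩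
  have hφcont : ContinuousOn φ s := by
    have : LipschitzOnWith 1 φ s := by
      refine lipschitzOnWith_one_of_le fun x hx y hy hxy => ?_
      rw [Real.dist_eq, abs_sub_comm, abs_of_nonneg (sub_nonneg.2 (hφmono hx hy hxy))]
      exact hφlip x hx y hy hxy
    exact this.continuousOn
  set V := φ ℓ with hVdef
  have hVℓ : V ≤ ℓ := by
    have := hφlip 0 h0s ℓ hℓs hℓ
    rw [hφ0] at this
    linarith
  have hV0 : 0 ≤ V := hφ0 ▸ hφmono h0s hℓs hℓ
  have himg : φ '' s = Icc 0 V := by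
    refine Subset.antisymm ?_ ?_
    · rintro _ ⟨x, hx, rfl⟩
      exact ⟨hφ0 ▸ hφmono h0s hx hx.1, hφmono hx hℓs hx.2⟩
    · have := intermediate_value_Icc hℓ hφcont
      rwa [hφ0] at this
  have hspeed : HasUnitSpeedOn N (Icc 0 V) :=
    himg ▸ has_unit_speed_naturalParameterization f hbv h0s
  have hNlip : LipschitzOnWith 1 N (Icc 0 V) := by
    have key : ∀ x ∈ Icc 0 V, ∀ y ∈ Icc 0 V, x ≤ y → dist (N x) (N y) ≤ y - x := by
      intro x hx y hy hxy
      have h1 := eVariationOn.edist_le N (s := Icc 0 V ∩ Icc x y) (x := x) (y := y)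
        ⟨hx, left_mem_Icc.2 hxy⟩ ⟨hy, right_mem_Icc.2 hxy⟩
      rw [hspeed hx hy, edist_dist] at h1
      simpa using (ENNReal.ofReal_le_ofReal_iff (by simpa using hxy)).1 h1
    exact lipschitzOnWith_one_of_le key
  have hN0 : N 0 = N V := by
    have := hNφ 0 h0s
    rw [hφ0] at this
    rw [this, hVdef, hNφ ℓ hℓs, hf0]
  have hNimg : N '' Icc 0 V = f '' s := by
    rw [← himg, image_image]
    exact image_congr hNφ
  have hVpos : 0 < V := by
    refine lt_of_le_of_ne hV0 fun h => ?_
    rw [← hNimg, ← h, Icc_self, image_singleton] at hi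
    obtain ⟨p, hp, h1⟩ := hi (EuclideanSpace.single 0 1)
    obtain ⟨p', hp', h2⟩ := hi (-EuclideanSpace.single 0 1)
    rw [mem_singleton_iff] at hp hp'
    subst hp hp'
    rw [inner_neg_right, norm_neg] at h2
    have : ‖(EuclideanSpace.single 0 1 : E3)‖ = 1 := by simp
    linarith
  have : Fact (0 < V) := ⟨hVpos⟩
  refine (hγ.2 V (AddCircle.liftIco V 0 N) ⟨hVpos, ?_, lipschitzWith_liftIco hNlip hN0, ?_, ?_⟩).trans
    hVℓ
  · exact AddCircle.liftIco_zero_continuous hN0 hNlip.continuousOn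
  · have hcongr : EqOn (liftCurve V (AddCircle.liftIco V 0 N)) N (Icc 0 V) := by
      intro t ht
      rcases eq_or_lt_of_le ht.2 with rfl | h
      · have : ((V : ℝ) : AddCircle V) = ((0 : ℝ) : AddCircle V) := by simp
        simp only [liftCurve]
        rw [this, AddCircle.liftIco_zero_coe_apply ⟨le_rfl, hVpos⟩, hN0]
      · exact AddCircle.liftIco_zero_coe_apply ⟨ht.1, h⟩
    rw [eVariationOn.eq_of_eqOn hcongr]
    have := hspeed (left_mem_Icc.2 hV0) (right_mem_Icc.2 hV0)
    simpa using this
  · have hc : IsCompact (f '' s) := isCompact_Icc.image_of_continuousOn hf.continuousOn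
    refine (hi.sphere_subset hc).trans (convexHull_mono ?_)
    rw [← hNimg]
    rintro _ ⟨t, ht, rfl⟩
    rcases eq_or_lt_of_le ht.2 with rfl | h
    · exact ⟨((0 : ℝ) : AddCircle V), by
        rw [AddCircle.liftIco_zero_coe_apply ⟨le_rfl, hVpos⟩, hN0]⟩
    · exact ⟨(t : AddCircle V), AddCircle.liftIco_zero_coe_apply ⟨ht.1, h⟩⟩

/-- There is a `1`-Lipschitz path of length `ℓ` from `x` to `y` that visits every point of `C`. -/
def PathVia (x y : E3) (ℓ : ℝ) (C : Set E3) : Prop :=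
  0 ≤ ℓ ∧ ∃ f : ℝ → E3, LipschitzOnWith 1 f (Icc 0 ℓ) ∧ f 0 = x ∧ f ℓ = y ∧ C ⊆ f '' Icc 0 ℓ

lemma PathVia.trans {x y z : E3} {ℓ₁ ℓ₂ : ℝ} {C₁ C₂ : Set E3} (h₁ : PathVia x y ℓ₁ C₁)
    (h₂ : PathVia y z ℓ₂ C₂) : PathVia x z (ℓ₁ + ℓ₂) (C₁ ∪ C₂) := by
  obtain ⟨hℓ₁, f, hf, hf0, hf1, hfC⟩ := h₁
  obtain ⟨hℓ₂, k, hk, hk0, hk1, hkC⟩ := h₂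
  set F : ℝ → E3 := fun t => if t ≤ ℓ₁ then f t else k (t - ℓ₁) with hF
  have F1 : ∀ t, t ≤ ℓ₁ → F t = f t := fun t ht => if_pos ht
  have F2 : ∀ t, ℓ₁ ≤ t → F t = k (t - ℓ₁) := by
    intro t ht
    rcases eq_or_lt_of_le ht with rfl | h
    · rw [F1 _ le_rfl, hf1, sub_self, hk0]
    · exact if_neg h.not_ge
  have d1 : ∀ a b, 0 ≤ a → a ≤ b → b ≤ ℓ₁ → dist (F a) (F b) ≤ b - a := by
    intro a b h1 h2 h3
    rw [F1 a (h2.trans h3), F1 b h3]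
    have := hf.dist_le_mul a ⟨h1, h2.trans h3⟩ b ⟨h1.trans h2, h3⟩
    rwa [Real.dist_eq, abs_sub_comm, abs_of_nonneg (by linarith), NNReal.coe_one, one_mul] at this
  have d2 : ∀ a b, ℓ₁ ≤ a → a ≤ b → b ≤ ℓ₁ + ℓ₂ → dist (F a) (F b) ≤ b - a := by
    intro a b h1 h2 h3
    rw [F2 a h1, F2 b (h1.trans h2)]
    have := hk.dist_le_mul (a - ℓ₁) ⟨by linarith, by linarith⟩ (b - ℓ₁) ⟨by linarith, by linarith⟩
    rwa [Real.dist_eq, abs_sub_comm, abs_of_nonneg (by linarith), NNReal.coe_one, one_mul,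
      sub_sub_sub_cancel_right] at this
  refine ⟨by linarith, F, lipschitzOnWith_one_of_le fun a ha b hb hab => ?_, ?_, ?_, ?_⟩
  · rcases le_total b ℓ₁ with h | h
    · exact d1 a b ha.1 hab h
    rcases le_total ℓ₁ a with h' | h'
    · exact d2 a b h' hab hb.2
    have e1 := d1 a ℓ₁ ha.1 h' le_rfl
    have e2 := d2 ℓ₁ b le_rfl h hb.2
    linarith [dist_triangle (F a) (F ℓ₁) (F b)]
  · rw [F1 0 hℓ₁, hf0]
  · rw [F2 _ (by linarith), add_sub_cancel_left, hk1]
  · rintro p (hp | hp)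
    · obtain ⟨t, ht, rfl⟩ := hfC hp
      exact ⟨t, ⟨ht.1, by linarith [ht.2]⟩, F1 t ht.2⟩
    · obtain ⟨t, ht, rfl⟩ := hkC hp
      exact ⟨ℓ₁ + t, ⟨by linarith [ht.1], by linarith [ht.2]⟩, by
        rw [F2 _ (by linarith [ht.1]), add_sub_cancel_left]⟩

lemma PathVia.mono {x y : E3} {ℓ : ℝ} {C D : Set E3} (h : PathVia x y ℓ C) (hD : D ⊆ C) :
    PathVia x y ℓ D :=
  let ⟨hℓ, f, hf, h0, h1, hC⟩ := h
  ⟨hℓ, f, hf, h0, h1, hD.trans hC⟩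

lemma pathVia_segment (x y : E3) : PathVia x y ‖x - y‖ {x, y} := by
  rcases eq_or_ne x y with rfl | hxy
  · exact ⟨norm_nonneg _, fun _ => x, (LipschitzWith.const' x).lipschitzOnWith, rfl, rfl, by
      rintro p hp
      simp only [mem_insert_iff, mem_singleton_iff, or_self] at hp
      exact ⟨0, ⟨le_rfl, norm_nonneg _⟩, hp.symm⟩⟩
  have hpos : 0 < ‖x - y‖ := norm_sub_pos_iff.2 hxy
  have h0 : x + (0 * ‖x - y‖⁻¹) • (y - x) = x := by simp
  have h1 : x + (‖x - y‖ * ‖x - y‖⁻¹) • (y - x) = y := by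
    rw [mul_inv_cancel₀ hpos.ne', one_smul, add_sub_cancel]
  refine ⟨norm_nonneg _, fun t => x + (t * ‖x - y‖⁻¹) • (y - x),
    lipschitzOnWith_one_of_le fun a _ b _ hab => ?_, h0, h1, ?_⟩
  · rw [dist_add_left, dist_eq_norm, ← sub_smul, ← sub_mul, norm_smul, norm_mul, norm_inv,
      norm_norm,
      norm_sub_rev y x, mul_assoc, inv_mul_cancel₀ hpos.ne', mul_one, Real.norm_eq_abs,
      abs_sub_comm, abs_of_nonneg (by linarith)]
  · rintro p (rfl | rfl)
    · exact ⟨0, ⟨le_rfl, norm_nonneg _⟩, h0⟩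
    · exact ⟨_, ⟨norm_nonneg _, le_rfl⟩, h1⟩

lemma pathVia_arc {g : ℝ → E3} {a b : ℝ} (hg : LipschitzOnWith 1 g (Icc a b)) (hab : a ≤ b) :
    PathVia (g a) (g b) (b - a) (g '' Icc a b) := by
  refine ⟨by linarith, fun t => g (a + t), lipschitzOnWith_one_of_le fun s hs t ht hst => ?_,
    by simp, by simp, ?_⟩
  · have := hg.dist_le_mul (a + s) ⟨by linarith [hs.1], by linarith [hs.2]⟩ (a + t)
      ⟨by linarith [ht.1], by linarith [ht.2]⟩
    rwa [Real.dist_eq, abs_sub_comm, abs_of_nonneg (by linarith), NNReal.coe_one, one_mul,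
      add_sub_add_left_eq_sub] at this
  · rintro _ ⟨t, ht, rfl⟩
    exact ⟨t - a, ⟨by linarith [ht.1], by linarith [ht.2]⟩, by simp⟩

/-- The properties of (the lift of) a minimal inspection curve used below: it is a `1`-Lipschitz
`L`-periodic curve inspecting the sphere, and no shorter loop does so. -/
structure MinLoop (L : ℝ) (g : ℝ → E3) : Prop where
  pos : 0 < L
  lip : LipschitzWith 1 g
  per : ∀ t, g (t + L) = g t
  insp : Inspects (range g)
  le_length : ∀ x ℓ C, PathVia x x ℓ C → Inspects C → L ≤ ℓ

lemma IsMinInspectionCurve.minLoop {L : ℝ} {γ : AddCircle L → E3}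
    (hγ : IsMinInspectionCurve L γ) : MinLoop L (liftCurve L γ) where
  pos := hγ.1.1
  lip := hγ.1.2.2.1
  per t := by simp [liftCurve]
  insp := by
    have h := inspects_of_sphere_subset hγ.1.2.2.2.2
    refine h.mono ?_
    rintro _ ⟨s, rfl⟩
    obtain ⟨t, rfl⟩ := QuotientAddGroup.mk_surjective s
    exact ⟨t, rfl⟩
  le_length := by
    rintro x ℓ C ⟨hℓ, f, hf, h0, h1, hC⟩ hi
    exact hγ.le_of_loop hℓ hf (h0.trans h1.symm) (hi.mono hC)

namespace MinLoop

variable {L : ℝ} {g : ℝ → E3}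

lemma dist_le (h : MinLoop L g) {s t : ℝ} (hst : s ≤ t) : ‖g s - g t‖ ≤ t - s := by
  have := h.lip.dist_le_mul s t
  rwa [Real.dist_eq, abs_sub_comm, abs_of_nonneg (by linarith), NNReal.coe_one, one_mul,
    dist_eq_norm] at this

/-- The reversed curve. -/
lemma rev (h : MinLoop L g) : MinLoop L (fun t => g (-t)) where
  pos := h.pos
  lip := by
    simpa using LipschitzWith.of_dist_le_mul (K := 1) (f := fun t => g (-t)) fun s t => by
      simpa [dist_neg_neg] using h.lip.dist_le_mul (-s) (-t)
  per t := by
    rw [← h.per (-(t + L)), neg_add, neg_add_cancel_right]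
  insp := h.insp.mono (by
    rintro _ ⟨t, rfl⟩
    exact ⟨-t, by simp⟩)
  le_length := h.le_length

/-- Every value is attained in any window of one period. -/
lemma exists_mem_Icc (h : MinLoop L g) (a t : ℝ) : ∃ s ∈ Icc a (a + L), g s = g t := by
  obtain ⟨s, hs, he⟩ := Function.Periodic.exists_mem_Ico (c := L) (f := g) h.per h.pos t a
  exact ⟨s, Ico_subset_Icc_self hs, he.symm⟩

/-- Uniform interior points of the convex hull of the curve, in terms of support numbers. -/
def Inner (g : ℝ → E3) (x : E3) : Prop :=
  ∃ ε > 0, ∀ v : E3, ∃ t, inner ℝ x v + ε * ‖v‖ ≤ inner ℝ (g t) v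

lemma Inner.ball {x : E3} (hx : Inner g x) : ∃ ε > 0, ∀ y, ‖y - x‖ < ε → Inner g y := by
  obtain ⟨ε, hε, h⟩ := hx
  refine ⟨ε / 2, by linarith, fun y hy => ⟨ε / 2, by linarith, fun v => ?_⟩⟩
  obtain ⟨t, ht⟩ := h v
  refine ⟨t, ?_⟩
  have h1 : inner ℝ y v = inner ℝ x v + inner ℝ (y - x) v := by rw [inner_sub_left]; ring
  have h2 := real_inner_le_norm (y - x) v
  have h3 : ‖y - x‖ * ‖v‖ ≤ ε / 2 * ‖v‖ := by gcongr
  linarith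

lemma inner_of_norm_lt (h : MinLoop L g) {x : E3} (hx : ‖x‖ < 1) : Inner g x := by
  refine ⟨1 - ‖x‖, by linarith, fun v => ?_⟩
  obtain ⟨_, ⟨t, rfl⟩, ht⟩ := h.insp v
  refine ⟨t, ?_⟩
  have := real_inner_le_norm x v
  linarith

lemma Inner.combo {y : E3} (hy : Inner g y) (s : ℝ) {c : ℝ} (hc : 0 < c) (hc1 : c ≤ 1) :
    Inner g (c • y + (1 - c) • g s) := by
  obtain ⟨ε, hε, h⟩ := hy
  refine ⟨c * ε, by positivity, fun v => ?_⟩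
  obtain ⟨t, ht⟩ := h v
  rw [inner_add_left, inner_smul_left, inner_smul_left]
  simp only [conj_trivial]
  rcases le_total (inner ℝ (g s) v) (inner ℝ (g t) v) with hle | hle
  · exact ⟨t, by nlinarith⟩
  · exact ⟨s, by nlinarith⟩

lemma exists_max (h : MinLoop L g) (a : ℝ) (v : E3) :
    ∃ t ∈ Icc a (a + L), ∀ s, inner ℝ (g s) v ≤ inner ℝ (g t) v := by
  have hc : Continuous fun t => inner ℝ (g t) v := h.lip.continuous.inner continuous_const
  obtain ⟨t, ht, hmax⟩ := isCompact_Icc.exists_isMaxOn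
    (nonempty_Icc.2 (by linarith [h.pos] : a ≤ a + L)) hc.continuousOn
  refine ⟨t, ht, fun s => ?_⟩
  obtain ⟨s', hs', he⟩ := h.exists_mem_Icc a s
  rw [← he]
  exact hmax hs'

lemma norm_le_of_max (h : MinLoop L g) {v : E3} {t : ℝ}
    (ht : ∀ s, inner ℝ (g s) v ≤ inner ℝ (g t) v) : ‖v‖ ≤ inner ℝ (g t) v := by
  obtain ⟨_, ⟨s, rfl⟩, hs⟩ := h.insp v
  exact hs.trans (ht s)

lemma Inner.not_max {v : E3} (hv : v ≠ 0) {t : ℝ} (hi : Inner g (g t)) :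
    ¬ ∀ s, inner ℝ (g s) v ≤ inner ℝ (g t) v := by
  obtain ⟨ε, hε, h⟩ := hi
  obtain ⟨s, hs⟩ := h v
  have : 0 < ε * ‖v‖ := mul_pos hε (norm_pos_iff.2 hv)
  exact fun hmax => absurd (hmax s) (by linarith)

/-- A piece of a minimal inspection curve is straight if its points do not contribute to the convex
hull beyond its endpoints. -/
lemma short (h : MinLoop L g) {a b : ℝ} (hab : a ≤ b) (hb : b ≤ a + L)
    (hin : ∀ t ∈ Ioo a b, Inner g (g t) ∨ g t ∈ segment ℝ (g a) (g b)) :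
    ‖g a - g b‖ = b - a := by
  refine le_antisymm (h.dist_le hab) ?_
  have p1 := pathVia_arc (h.lip.lipschitzOnWith (s := Icc b (a + L))) hb
  have p2 := pathVia_segment (g a) (g b)
  rw [h.per a] at p1
  have := h.le_length _ _ _ (p1.trans p2) ?_
  · linarith
  intro v
  have ha' : g a ∈ g '' Icc b (a + L) ∪ {g a, g b} := by simp
  have hb' : g b ∈ g '' Icc b (a + L) ∪ {g a, g b} := by simp
  rcases eq_or_ne v 0 with rfl | hv
  · exact ⟨_, ha', by simp⟩
  obtain ⟨t, ht, hmax⟩ := h.exists_max a v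
  have hn := h.norm_le_of_max hmax
  by_cases htb : b ≤ t
  · exact ⟨g t, Or.inl ⟨t, ⟨htb, ht.2⟩, rfl⟩, hn⟩
  push Not at htb
  rcases eq_or_lt_of_le ht.1 with rfl | hat
  · exact ⟨_, ha', hn⟩
  rcases hin t ⟨hat, htb⟩ with hi | hs
  · exact absurd hmax (Inner.not_max hv hi)
  · obtain ⟨c, d, hc, hd, hcd, he⟩ := hs
    rw [← he, inner_add_left, inner_smul_left, inner_smul_left] at hn
    simp only [conj_trivial] at hn
    obtain rfl : d = 1 - c := by linarith
    rcases le_total (inner ℝ (g a) v) (inner ℝ (g b) v) with hle | hle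
    · exact ⟨_, hb', by linarith [mul_le_mul_of_nonneg_left hle hc]⟩
    · exact ⟨_, ha', by linarith [mul_le_mul_of_nonneg_left hle hd]⟩

end MinLoop

lemma lipschitzOnWith_of_circular {f : ℝ → E3}
    (hf : ∀ s t, ‖f s - f t‖ ^ 2 = (cos s - cos t) ^ 2 + (sin s - sin t) ^ 2) (S : Set ℝ) :
    LipschitzOnWith 1 f S := by
  refine lipschitzOnWith_one_of_le fun s _ t _ hst => ?_
  rw [dist_eq_norm]
  refine abs_le_of_sq_le_sq' ?_ (by linarith) |>.2
  rw [hf]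
  have h := Real.one_sub_sq_div_two_le_cos (x := t - s)
  rw [Real.cos_sub] at h
  nlinarith [Real.sin_sq_add_cos_sq s, Real.sin_sq_add_cos_sq t]

lemma exists_cos_sin {y z : ℝ} (hz : 0 ≤ z) :
    ∃ t ∈ Icc 0 π, y * cos t + z * sin t = √(y ^ 2 + z ^ 2) := by
  set ρ := √(y ^ 2 + z ^ 2) with hρ
  have hρ2 : ρ ^ 2 = y ^ 2 + z ^ 2 := Real.sq_sqrt (by positivity)
  have hρ0 : 0 ≤ ρ := Real.sqrt_nonneg _
  rcases eq_or_lt_of_le hρ0 with h0 | h0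
  · refine ⟨0, ⟨le_rfl, pi_pos.le⟩, ?_⟩
    rw [← h0] at hρ2
    have : y = 0 := by nlinarith
    rw [← h0, this]
    simp
  refine ⟨arccos (y / ρ), ⟨arccos_nonneg _, arccos_le_pi _⟩, ?_⟩
  have hy : |y| ≤ ρ := Real.abs_le_sqrt (by nlinarith)
  rw [abs_le] at hy
  have hsq : √(1 - (y / ρ) ^ 2) = z / ρ := by
    rw [show 1 - (y / ρ) ^ 2 = (z / ρ) ^ 2 by field_simp; linarith]
    exact Real.sqrt_sq (by positivity)
  rw [cos_arccos (by rw [le_div_iff₀ h0]; linarith) (by rw [div_le_iff₀ h0]; linarith),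
    sin_arccos, hsq]
  field_simp
  linarith

/-- Comparison with the curve made of four half-circles shows that a minimal inspection curve has
length at most `4π`. -/
lemma MinLoop.length_le {L : ℝ} {g : ℝ → E3} (h : MinLoop L g) : L ≤ 4 * π := by
  let A : ℝ → E3 := fun t => !₂[1, -cos t, sin t]
  let B : ℝ → E3 := fun t => !₂[cos t, 1, -sin t]
  let C : ℝ → E3 := fun t => !₂[-1, cos t, sin t]
  let D : ℝ → E3 := fun t => !₂[-cos t, -1, -sin t]
  have pA := pathVia_arc (lipschitzOnWith_of_circular (f := A) (by
    intro s t; simp [A, EuclideanSpace.norm_sq_eq, Fin.sum_univ_three]; ring) (Icc 0 π)) pi_pos.le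
  have pB := pathVia_arc (lipschitzOnWith_of_circular (f := B) (by
    intro s t; simp [B, EuclideanSpace.norm_sq_eq, Fin.sum_univ_three]; ring) (Icc 0 π)) pi_pos.le
  have pC := pathVia_arc (lipschitzOnWith_of_circular (f := C) (by
    intro s t; simp [C, EuclideanSpace.norm_sq_eq, Fin.sum_univ_three]) (Icc 0 π)) pi_pos.le
  have pD := pathVia_arc (lipschitzOnWith_of_circular (f := D) (by
    intro s t; simp [D, EuclideanSpace.norm_sq_eq, Fin.sum_univ_three]; ring) (Icc 0 π)) pi_pos.le
  have eB : B 0 = A π := by simp [A, B]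
  have eC : C 0 = B π := by simp [B, C]
  have eD : D 0 = C π := by simp [C, D]
  have eA : D π = A 0 := by simp [A, D]
  rw [eB] at pB
  rw [eC] at pC
  rw [eD, eA] at pD
  have := h.le_length _ _ _ (((pA.trans pB).trans pC).trans pD) ?_
  · linarith
  intro v
  have hv : ‖v‖ = √(v 0 ^ 2 + v 1 ^ 2 + v 2 ^ 2) := by
    simp [EuclideanSpace.norm_eq, Fin.sum_univ_three]
  have tri : ∀ x w : ℝ, 0 ≤ w → √(x ^ 2 + w) ≤ |x| + √w := by
    intro x w hw
    rw [Real.sqrt_le_left (by positivity)]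
    nlinarith [Real.sq_sqrt hw, sq_abs x, mul_nonneg (abs_nonneg x) (Real.sqrt_nonneg w)]
  have h1 := tri (v 0) (v 1 ^ 2 + v 2 ^ 2) (by positivity)
  have h2 := tri (v 1) (v 0 ^ 2 + v 2 ^ 2) (by positivity)
  rw [show v 0 ^ 2 + (v 1 ^ 2 + v 2 ^ 2) = v 0 ^ 2 + v 1 ^ 2 + v 2 ^ 2 by ring, ← hv] at h1
  rw [show v 1 ^ 2 + (v 0 ^ 2 + v 2 ^ 2) = v 0 ^ 2 + v 1 ^ 2 + v 2 ^ 2 by ring, ← hv] at h2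
  have hin : ∀ p : E3, inner ℝ p v = p 0 * v 0 + p 1 * v 1 + p 2 * v 2 := by
    intro p
    simp [PiLp.inner_apply, Fin.sum_univ_three, mul_comm]
  rcases le_total 0 (v 2) with hc | hc
  · rcases le_total 0 (v 0) with ha | ha
    · obtain ⟨t, ht, he⟩ := exists_cos_sin (y := -v 1) hc
      refine ⟨A t, Or.inl (Or.inl (Or.inl ⟨t, ht, rfl⟩)), h1.trans ?_⟩
      rw [neg_sq] at he
      rw [hin, abs_of_nonneg ha, ← he]
      simp [A]; linarith
    · obtain ⟨t, ht, he⟩ := exists_cos_sin (y := v 1) hc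
      refine ⟨C t, Or.inl (Or.inr ⟨t, ht, rfl⟩), h1.trans ?_⟩
      rw [hin, abs_of_nonpos ha, ← he]
      simp [C]; linarith
  · rcases le_total 0 (v 1) with ha | ha
    · obtain ⟨t, ht, he⟩ := exists_cos_sin (y := v 0) (neg_nonneg.2 hc)
      refine ⟨B t, Or.inl (Or.inl (Or.inr ⟨t, ht, rfl⟩)), h2.trans ?_⟩
      rw [neg_sq] at he
      rw [hin, abs_of_nonneg ha, ← he]
      simp [B]; linarith
    · obtain ⟨t, ht, he⟩ := exists_cos_sin (y := -v 0) (neg_nonneg.2 hc)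
      refine ⟨D t, Or.inr ⟨t, ht, rfl⟩, h2.trans ?_⟩
      rw [neg_sq, neg_sq] at he
      rw [hin, abs_of_nonpos ha, ← he]
      simp [D]; linarith

/-- A closed curve in `ℝ` travels at least twice the distance between any two of its points. -/
lemma two_mul_abs_sub_le_integral_abs_deriv {φ : ℝ → ℝ} {K : NNReal} (hφ : LipschitzWith K φ)
    {a b s t : ℝ} (hs : s ∈ Icc a b) (ht : t ∈ Icc a b) (hab : φ a = φ b) :
    2 * |φ s - φ t| ≤ ∫ x in a..b, |deriv φ x| := by
  wlog hst : s ≤ t generalizing s t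
  · rw [abs_sub_comm]
    exact this ht hs (le_of_not_ge hst)
  have hInt : ∀ x y, IntervalIntegrable (fun x => |deriv φ x|) volume x y := fun x y =>
    ((hφ.lipschitzOnWith (s := uIcc x y)).absolutelyContinuousOnInterval.intervalIntegrable_deriv).abs
  have hle : ∀ x y, x ≤ y → |φ y - φ x| ≤ ∫ u in x..y, |deriv φ u| := by
    intro x y hxy
    rw [← ((hφ.lipschitzOnWith (s := uIcc x y)).absolutelyContinuousOnInterval).integral_deriv_eq_sub]
    exact intervalIntegral.abs_integral_le_integral_abs hxy
  rw [← intervalIntegral.integral_add_adjacent_intervals (hInt a s) (hInt s b),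
    ← intervalIntegral.integral_add_adjacent_intervals (hInt s t) (hInt t b)]
  have h1 := hle a s hs.1
  have h2 := hle s t hst
  have h3 := hle t b ht.2
  have h4 := abs_sub_le (φ s) (φ a) (φ t)
  rw [abs_sub_comm (φ t) (φ s)] at h2
  rw [hab, abs_sub_comm (φ b) (φ t)] at *
  linarith

/-- The length of a closed curve is at least twice the diagonal of any box spanned by it. -/
lemma extent_sq_le {g : ℝ → E3} (hg : LipschitzWith 1 g) {a b : ℝ} (hab : a ≤ b)
    (hc : g a = g b) (e : OrthonormalBasis (Fin 3) ℝ E3) (s t : Fin 3 → ℝ)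
    (hs : ∀ i, s i ∈ Icc a b) (ht : ∀ i, t i ∈ Icc a b) :
    4 * ∑ i, (inner ℝ (e i) (g (s i)) - inner ℝ (e i) (g (t i))) ^ 2 ≤ (b - a) ^ 2 := by
  set φ : Fin 3 → ℝ → ℝ := fun i x => inner ℝ (e i) (g x) with hφ
  have hφL : ∀ i, LipschitzWith 1 (φ i) := by
    intro i
    refine LipschitzWith.of_dist_le_mul fun x y => ?_
    have h1 := hg.dist_le_mul x y
    have h2 := abs_real_inner_le_norm (e i) (g x - g y)
    rw [e.norm_eq_one, one_mul, inner_sub_right] at h2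
    rw [dist_eq_norm] at h1
    exact h2.trans h1
  set c : Fin 3 → ℝ := fun i => |φ i (s i) - φ i (t i)| with hcdef
  have hcsq : ∑ i, (φ i (s i) - φ i (t i)) ^ 2 = ∑ i, c i ^ 2 := by simp [hcdef]
  change 4 * ∑ i, (φ i (s i) - φ i (t i)) ^ 2 ≤ _
  rw [hcsq]
  set S := ∑ i, c i ^ 2 with hS
  have hS0 : 0 ≤ S := Finset.sum_nonneg fun i _ => sq_nonneg _
  have hInt : ∀ i, IntervalIntegrable (fun x => |deriv (φ i) x|) volume a b := fun i =>
    (((hφL i).lipschitzOnWith (s := uIcc a b)).absolutelyContinuousOnInterval.intervalIntegrable_deriv).abs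
  have hlow : 2 * S ≤ ∫ x in a..b, ∑ i, c i * |deriv (φ i) x| := by
    rw [intervalIntegral.integral_finsetSum fun i _ => (hInt i).const_mul _, hS, Finset.mul_sum]
    refine Finset.sum_le_sum fun i _ => ?_
    rw [intervalIntegral.integral_const_mul]
    have := two_mul_abs_sub_le_integral_abs_deriv (hφL i) (hs i) (ht i) (by simp [hφ, hc])
    have hc0 : 0 ≤ c i := abs_nonneg _
    calc 2 * c i ^ 2 = c i * (2 * c i) := by ring
      _ ≤ _ := by gcongr
  have hup : (∫ x in a..b, ∑ i, c i * |deriv (φ i) x|) ≤ ∫ x in a..b, √S := by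
    refine intervalIntegral.integral_mono_ae hab ?_ (by simp) ?_
    · rw [show (fun x => ∑ i, c i * |deriv (φ i) x|) = ∑ i, fun x => c i * |deriv (φ i) x| by
        ext x; simp]
      exact IntervalIntegrable.sum _ fun i _ => (hInt i).const_mul _
    · filter_upwards [hg.ae_differentiableAt_real] with x hx
      have hd : ∀ i, deriv (φ i) x = inner ℝ (e i) (deriv g x) := by
        intro i
        have := (hasDerivAt_const x (e i)).inner ℝ hx.hasDerivAt
        simpa [hφ] using this.deriv
      have hn : ‖deriv g x‖ ≤ 1 := by simpa using norm_deriv_le_of_lipschitz (x₀ := x) hg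
      refine Real.le_sqrt_of_sq_le ?_
      refine (Finset.sum_mul_sq_le_sq_mul_sq _ _ _).trans ?_
      have : ∑ i, |deriv (φ i) x| ^ 2 ≤ 1 := by
        have hb := e.sum_sq_norm_inner_right (deriv g x)
        simp only [Real.norm_eq_abs] at hb
        simp only [hd]
        rw [hb]
        exact pow_le_one₀ (norm_nonneg _) hn
      nlinarith
  rw [intervalIntegral.integral_const, smul_eq_mul] at hup
  have h2 : 2 * S ≤ (b - a) * √S := hlow.trans hup
  have h3 := Real.sq_sqrt hS0
  have h4 := Real.sqrt_nonneg S
  rcases eq_or_lt_of_le h4 with h | h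
  · rw [← h] at h3; nlinarith [sq_nonneg (b - a)]
  · have : 2 * √S ≤ b - a := by
      by_contra! hlt
      nlinarith
    nlinarith

/-- Equality in the triangle inequality. -/
lemma smul_eq_smul_of_norm_add {x y : E3} {a b : ℝ} (hx : ‖x‖ = a) (hy : ‖y‖ = b)
    (hxy : ‖x + y‖ = a + b) : (a + b) • x = a • (x + y) := by
  have h1 : ‖x + y‖ ^ 2 = ‖x‖ ^ 2 + 2 * inner ℝ x y + ‖y‖ ^ 2 := norm_add_sq_real x y
  have h2 : ‖b • x - a • y‖ ^ 2 = 0 := by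
    rw [norm_sub_sq_real, norm_smul, norm_smul, inner_smul_left, inner_smul_right,
      mul_pow, mul_pow, Real.norm_eq_abs, Real.norm_eq_abs, sq_abs, sq_abs, hx, hy]
    rw [hx, hy, hxy] at h1
    simp only [conj_trivial]
    have h3 : inner ℝ x y = a * b := by nlinarith
    rw [h3]
    ring
  have h3 : b • x - a • y = 0 := by simpa using h2
  rw [sub_eq_zero] at h3
  rw [add_smul, smul_add, h3]

namespace MinLoop

variable {L : ℝ} {g : ℝ → E3}

/-- Inside the convex hull, a minimal inspection curve is locally a straight segment. -/
lemma locally_straight (h : MinLoop L g) {t : ℝ} (ht : Inner g (g t)) :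
    ∃ ε > 0, ∃ w : E3, ‖w‖ = 1 ∧ ∀ τ ∈ Icc (-ε) ε, g (t + τ) = g t + τ • w := by
  obtain ⟨η, hη, hball⟩ := ht.ball
  obtain ⟨ε, hε, hεη, hεL⟩ : ∃ ε > 0, ε < η ∧ 2 * ε ≤ L :=
    ⟨min (η / 2) (L / 2), by have := h.pos; positivity,
      (min_le_left _ _).trans_lt (by linarith), by linarith [min_le_right (η / 2) (L / 2)]⟩
  have hinner : ∀ s ∈ Icc (t - ε) (t + ε), Inner g (g s) := by
    intro s hs
    refine hball _ (lt_of_le_of_lt ?_ hεη)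
    have := h.lip.dist_le_mul s t
    rw [NNReal.coe_one, one_mul, dist_eq_norm] at this
    refine this.trans ?_
    rw [Real.dist_eq, abs_le]
    exact ⟨by linarith [hs.1], by linarith [hs.2]⟩
  have hiso : ∀ a b, t - ε ≤ a → a ≤ b → b ≤ t + ε → ‖g b - g a‖ = b - a := by
    intro a b h1 h2 h3
    rw [norm_sub_rev]
    exact h.short h2 (by linarith) fun s hs =>
      Or.inl (hinner s ⟨by linarith [hs.1], by linarith [hs.2]⟩)
  set A := g (t - ε)
  set B := g (t + ε)
  have hAB : ‖B - A‖ = 2 * ε := by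
    rw [hiso _ _ le_rfl (by linarith) le_rfl]
    ring
  set w := (2 * ε)⁻¹ • (B - A) with hw
  have hline : ∀ τ ∈ Icc (-ε) ε, g (t + τ) = A + (ε + τ) • w := by
    intro τ hτ
    have h1 := hiso (t - ε) (t + τ) le_rfl (by linarith [hτ.1]) (by linarith [hτ.2])
    have h2 := hiso (t + τ) (t + ε) (by linarith [hτ.1]) (by linarith [hτ.2]) le_rfl
    have h3 := smul_eq_smul_of_norm_add h1 h2 (by
      rw [add_comm, sub_add_sub_cancel, hAB]
      ring)
    rw [add_comm (g (t + τ) - _), sub_add_sub_cancel,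
      show t + τ - (t - ε) + (t + ε - (t + τ)) = 2 * ε by ring,
      show t + τ - (t - ε) = ε + τ by ring] at h3
    rw [hw, smul_comm, ← h3, inv_smul_smul₀ (by positivity), add_sub_cancel]
  refine ⟨ε, hε, w, ?_, fun τ hτ => ?_⟩
  · rw [hw, norm_smul, hAB, norm_inv, Real.norm_of_nonneg (by positivity),
      inv_mul_cancel₀ (by positivity)]
  · have h0 := hline 0 ⟨by linarith, hε.le⟩
    rw [add_zero, add_zero] at h0
    rw [hline τ hτ, h0, add_smul, add_assoc]

/-- A straight radial piece of a minimal inspection curve leaving the point `H • û` towards the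
origin continues until `-û`. -/
lemma extend_ray (h : MinLoop L g) {u H δ : ℝ} {û : E3} (hû : ‖û‖ = 1) (hH : 1 ≤ H) (hδ : 0 < δ)
    (hδH : δ ≤ H + 1) (hray : ∀ τ ∈ Icc 0 δ, g (u + τ) = (H - τ) • û) :
    ∀ τ ∈ Icc 0 (H + 1), g (u + τ) = (H - τ) • û := by
  set S : Set ℝ := {σ | ∀ τ ∈ Icc 0 σ, g (u + τ) = (H - τ) • û} with hS
  have hu : g u = H • û := by simpa using hray 0 ⟨le_rfl, hδ.le⟩
  have hsub : Icc δ (H + 1) ⊆ S := by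
    refine IsClosed.Icc_subset_of_forall_exists_gt ?_ hray ?_
    · refine IsSeqClosed.isClosed fun x y hx hxy => ?_
      refine ⟨fun τ hτ => ?_, isClosed_Icc.isSeqClosed (fun n => (hx n).2) hxy⟩
      rcases eq_or_lt_of_le hτ.2 with rfl | hlt
      · have h1 : Filter.Tendsto (fun n => g (u + x n)) Filter.atTop (nhds (g (u + τ))) :=
          (h.lip.continuous.tendsto _).comp (hxy.const_add u)
        have h2 : Filter.Tendsto (fun n => g (u + x n)) Filter.atTop (nhds ((H - τ) • û)) := by
          refine ((hxy.const_sub H).smul_const û).congr fun n => ?_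
          exact ((hx n).1 (x n) ⟨hδ.le.trans (hx n).2.1, le_rfl⟩).symm
        exact tendsto_nhds_unique h1 h2
      · obtain ⟨n, hn⟩ := (hxy.eventually (lt_mem_nhds hlt)).exists
        exact (hx n).1 τ ⟨hτ.1, hn.le⟩
    · intro σ hσ y hy
      have hσ0 : 0 < σ := hδ.trans_le hσ.2.1
      have hgσ : g (u + σ) = (H - σ) • û := hσ.1 σ ⟨hσ0.le, le_rfl⟩
      have hinner : Inner g (g (u + σ)) := by
        set η := max 0 (σ - H) with hη
        have hη0 : 0 ≤ η := le_max_left _ _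
        have hη1 : η < 1 := max_lt one_pos (by linarith [hσ.2.2])
        have hη2 : σ ≤ H + η := by linarith [le_max_right 0 (σ - H)]
        have hpos : 0 < H + η := by linarith
        have := (h.inner_of_norm_lt (x := (-η) • û) (by
          rw [norm_smul, hû, Real.norm_eq_abs, abs_neg, abs_of_nonneg hη0, mul_one]
          exact hη1)).combo u (c := σ / (H + η)) (by positivity) (by rwa [div_le_one hpos])
        rw [hu, smul_smul, smul_smul, ← add_smul] at this
        rw [hgσ]
        convert this using 2
        field_simp
        ring
      obtain ⟨ε, hε, w, hw, hline⟩ := h.locally_straight hinner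
      have hwû : w = -û := by
        set κ := min ε σ
        have hκ : 0 < κ := lt_min hε hσ0
        have h1 := hline (-κ) ⟨by linarith [min_le_left ε σ], by linarith⟩
        have h2 := hσ.1 (σ - κ) ⟨by linarith [min_le_right ε σ], by linarith⟩
        rw [← add_sub_assoc, ← sub_eq_add_neg] at *
        rw [h2, hgσ] at h1
        have h3 : κ • (w + û) = 0 := by
          have : κ • (w + û) = ((H - (σ - κ)) • û) - ((H - σ) • û + (-κ) • w) := by
            module
          rw [this, h1, sub_self]
        have := (smul_eq_zero.1 h3).resolve_left hκ.ne'
        exact eq_neg_of_add_eq_zero_left this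
      refine ⟨min y (σ + ε), fun τ hτ => ?_, lt_min hy (by linarith), min_le_left _ _⟩
      rcases le_total τ σ with hle | hle
      · exact hσ.1 τ ⟨hτ.1, hle⟩
      · have := hline (τ - σ) ⟨by linarith, by linarith [hτ.2, min_le_right y (σ + ε)]⟩
        rw [show u + σ + (τ - σ) = u + τ by ring, hgσ, hwû] at this
        rw [this]
        module
  exact hsub ⟨hδH, le_rfl⟩

/-- If a minimal inspection curve moves along a ray from the origin and returns, then it
contains a doubly covered radial segment from `-û` to a point `H • û` with `H ≥ 1`. -/
lemma exists_spike (h : MinLoop L g) {a b : ℝ} (hab : a < b) (hbL : b ≤ a + L) {û : E3}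
    (hû : ‖û‖ = 1) (hray : ∀ t ∈ Icc a b, g t = ‖g t‖ • û) (hgab : g a = g b) :
    ∃ u H : ℝ, 1 ≤ H ∧ ∀ τ ∈ Icc 0 (H + 1),
      g (u + τ) = (H - τ) • û ∧ g (u - τ) = (H - τ) • û := by
  obtain ⟨u, hu, hmax⟩ := isCompact_Icc.exists_isMaxOn (nonempty_Icc.2 hab.le)
    (h.lip.continuous.norm.continuousOn)
  set H := ‖g u‖ with hH
  have hle : ∀ t ∈ Icc a b, ‖g t‖ ≤ H := fun t ht => hmax ht
  have hnsub : ∀ s ∈ Icc a b, ∀ t ∈ Icc a b, ‖g s - g t‖ = |‖g s‖ - ‖g t‖| := by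
    intro s hs t ht
    rw [hray s hs, hray t ht, ← sub_smul, norm_smul, hû, mul_one, Real.norm_eq_abs]
    simp [norm_smul, hû]
  have hgood : ∀ s ∈ Icc a b, Inner g (g s) ∨ g s = g u := by
    intro s hs
    rcases eq_or_lt_of_le (hle s hs) with heq | hlt
    · right
      rw [hray s hs, heq, hray u hu]
    · left
      have hHpos : 0 < H := (norm_nonneg _).trans_lt hlt
      have := (h.inner_of_norm_lt (x := 0) (by simp)).combo u (c := 1 - ‖g s‖ / H)
        (by rw [sub_pos, div_lt_one hHpos]; exact hlt)
        (by linarith [div_nonneg (norm_nonneg (g s)) hHpos.le])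
      rw [hray u hu, smul_zero, zero_add, smul_smul, show 1 - (1 - ‖g s‖ / H) = ‖g s‖ / H by ring,
        ← hH,
        div_mul_cancel₀ _ hHpos.ne', ← hray s hs] at this
      exact this
  have hright : ∀ t ∈ Icc u b, ‖g t‖ = H - (t - u) := by
    intro t ht
    have ht' : t ∈ Icc a b := ⟨hu.1.trans ht.1, ht.2⟩
    have := h.short ht.1 (by linarith [hu.1, ht.2]) fun s hs =>
      (hgood s ⟨by linarith [hu.1, hs.1], by linarith [ht.2, hs.2]⟩).imp_right
        fun (he : g s = g u) => he ▸ left_mem_segment ℝ _ _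
    rw [hnsub u hu t ht', abs_of_nonneg (by linarith [hle t ht'])] at this
    linarith
  have hleft : ∀ t ∈ Icc a u, ‖g t‖ = H - (u - t) := by
    intro t ht
    have ht' : t ∈ Icc a b := ⟨ht.1, ht.2.trans hu.2⟩
    have := h.short ht.2 (by linarith [hu.2, ht.1]) fun s hs =>
      (hgood s ⟨by linarith [ht.1, hs.1], by linarith [hu.2, hs.2]⟩).imp_right
        fun (he : g s = g u) => he ▸ right_mem_segment ℝ _ _
    rw [hnsub t ht' u hu, abs_of_nonpos (by linarith [hle t ht'])] at this
    linarith
  have ha := hleft a ⟨le_rfl, hu.1⟩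
  have hb := hright b ⟨hu.2, le_rfl⟩
  rw [hgab] at ha
  have hH1 : 1 ≤ H := by
    by_contra! hlt
    have := h.short hab.le hbL fun s hs => Or.inl
      (h.inner_of_norm_lt ((hle s (Ioo_subset_Icc_self hs)).trans_lt hlt))
    rw [hgab, sub_self, norm_zero] at this
    linarith
  set δ := min (b - u) (H + 1) with hδ
  have hδpos : 0 < δ := lt_min (by linarith) (by linarith)
  have hδb : δ ≤ b - u := min_le_left _ _
  have e1 := h.extend_ray (u := u) hû hH1 hδpos (min_le_right _ _) fun τ hτ => by
    rw [hray _ ⟨by linarith [hu.1, hτ.1], by linarith [hτ.2]⟩,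
      hright _ ⟨by linarith [hτ.1], by linarith [hτ.2]⟩, add_sub_cancel_left]
  have e2 := h.rev.extend_ray (u := -u) hû hH1 hδpos (min_le_right _ _) fun τ hτ => by
    rw [show -(-u + τ) = u - τ by ring,
      hray _ ⟨by linarith [hτ.2], by linarith [hu.2, hτ.1]⟩,
      hleft _ ⟨by linarith [hτ.2], by linarith [hτ.1]⟩, _root_.sub_sub_cancel]
  refine ⟨u, H, hH1, fun τ hτ => ⟨e1 τ hτ, ?_⟩⟩
  have := e2 τ hτ
  change g (-(-u + τ)) = _ at this
  rwa [show -(-u + τ) = u - τ by ring] at this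

end MinLoop

lemma extents_high_poly {r ω : ℝ} (hr : 2 ≤ r) (hr' : r ≤ 4.1) (h1 : 0.6 * r ≤ ω) (h2 : ω ≤ r) :
    (r ^ 2 - 2 * r + 0.01) * (6.2832 - r) ^ 2 <
      5 * ω ^ 2 + 2 * (r ^ 2 - 2 * r + 0.01) * (r - ω) * (r + 2) := by
  have p1 : (r - 2) * (6.2832 - r) ^ 2 < 4.45 * r := by
    nlinarith [mul_nonneg (sub_nonneg.2 hr) (sq_nonneg (r - 3.4)), sq_nonneg (r - 3.4)]
  have e1 : (r ^ 2 - 2 * r + 0.01) * (6.2832 - r) ^ 2 < 4.55 * r ^ 2 := by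
    nlinarith
  have e2 : (r ^ 2 - 2 * r + 0.01) * (6.2832 - r) ^ 2 <
      1.75 * r ^ 2 + (r ^ 2 - 2 * r + 0.01) * (0.8 * r * (r + 2)) := by
    have : (r - 2) * ((6.2832 - r) ^ 2 - 0.8 * r * (r + 2)) < 1.7 * r := by
      nlinarith [mul_nonneg (sub_nonneg.2 hr) (sq_nonneg (r - 2.3)), sq_nonneg (r - 2.3)]
    nlinarith
  obtain ⟨d, rfl⟩ : ∃ d, ω = r - d * r := ⟨1 - ω / r, by field_simp; ring⟩
  have d0 : 0 ≤ d := by by_contra! h; nlinarith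
  have d1 : d ≤ 0.4 := by by_contra! h; nlinarith
  have c1 := mul_le_mul_of_nonneg_left e1.le (sub_nonneg.2 d1)
  have c2 := mul_le_mul_of_nonneg_left e2.le d0
  nlinarith [mul_nonneg (sq_nonneg (d - 0.3)) (sq_nonneg r)]

lemma extents_long_poly {r k μ : ℝ} (hr : 2.35 ≤ r) (hr' : r ≤ 4.1)
    (hk2 : k ^ 2 = r ^ 2 - 2 * r + 0.01) (hμ : 1 ≤ μ) :
    (6.2832 - r) ^ 2 < 2 * r ^ 2 - 2 * r * (k * μ) + 2 * (r - k * μ / 3) * μ + 5 * μ ^ 2 := by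
  have red : ∀ K, k ≤ K → 2 * r * (k * μ) + 2 * (k * μ / 3) * μ ≤
      K * (2 * r * μ + 2 / 3 * μ ^ 2) := by
    intro K hK
    have : 0 ≤ 2 * r * μ + 2 / 3 * μ ^ 2 := by positivity
    nlinarith
  obtain ⟨n, rfl⟩ : ∃ n, μ = 1 + n := ⟨μ - 1, by ring⟩
  have hn : 0 ≤ n := by linarith
  rcases le_total r 3 with h3 | h3
  · have hkr : k ≤ 1.4215 * r - 2.424 :=
      abs_le_of_sq_le_sq' (by nlinarith [sq_nonneg (r - 2.4)]) (by linarith) |>.2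
    have := red _ hkr
    have q : (6.2832 - r) ^ 2 < 2 * r ^ 2 + 2 * r * (1 + n) + 5 * (1 + n) ^ 2 -
      (1.4215 * r - 2.424) * (2 * r * (1 + n) + 2 / 3 * (1 + n) ^ 2) := by
      nlinarith [mul_nonneg (sub_nonneg.2 hr) (sub_nonneg.2 h3),
        mul_nonneg (mul_nonneg (sub_nonneg.2 hr) (sub_nonneg.2 h3)) hn,
        mul_nonneg (sub_nonneg.2 h3) (sq_nonneg n), mul_nonneg (sub_nonneg.2 hr) hn,
        mul_nonneg (sub_nonneg.2 h3) hn, sq_nonneg (n - 0.2)]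
    nlinarith
  · have hkr : k ≤ 1.16 * r - 1.72 := abs_le_of_sq_le_sq' (by nlinarith) (by linarith) |>.2
    have := red _ hkr
    have q : (6.2832 - r) ^ 2 < 2 * r ^ 2 + 2 * r * (1 + n) + 5 * (1 + n) ^ 2 -
      (1.16 * r - 1.72) * (2 * r * (1 + n) + 2 / 3 * (1 + n) ^ 2) := by
      nlinarith [mul_nonneg (sub_nonneg.2 hr') (sub_nonneg.2 h3),
        mul_nonneg (mul_nonneg (sub_nonneg.2 hr') (sub_nonneg.2 h3)) hn,
        mul_nonneg (sub_nonneg.2 hr') (sq_nonneg (n - 1.5)),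
        mul_nonneg (sub_nonneg.2 h3) (sq_nonneg (n - 1.5)), mul_nonneg (sub_nonneg.2 hr') hn,
        mul_nonneg (sub_nonneg.2 h3) hn, sq_nonneg (n - 1)]
    nlinarith

/-- The common lower bound for the squared extents when `ω` is small. -/
lemma sq_extents_ge {r k ω ξ m : ℝ} (hr : 0 ≤ r) (h1 : 0 ≤ ω) (h2 : ω ≤ 0.6 * r) (hm : 1 ≤ m)
    (hω : ω ≤ k * m) (hξ : 0 ≤ ξ) (hd : r ^ 2 ≤ ξ ^ 2 + ω ^ 2) :
    2 * r ^ 2 - 2 * r * (k * m) + 2 * (r - k * m / 3) * m + m ^ 2 ≤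
      (ξ + m) ^ 2 + (r - ω) ^ 2 := by
  have hξ' : r - ω / 3 ≤ ξ := abs_le_of_sq_le_sq' (by nlinarith) hξ |>.2
  nlinarith [mul_le_mul_of_nonneg_left hω hr, mul_le_mul_of_nonneg_right hω (by linarith : 0 ≤ m),
    mul_le_mul_of_nonneg_right hξ' (by linarith : 0 ≤ m)]

set_option maxHeartbeats 800000 in
lemma extents_short {r k ω ξ m y Y : ℝ} (hr : 2 ≤ r) (hr' : r ≤ 2.35) (hk : 0 ≤ k)
    (hk2 : k ^ 2 = r ^ 2 - 2 * r + 0.01) (h1 : 0 ≤ ω) (h2 : ω ≤ 0.6 * r) (hm : 1 ≤ m)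
    (hω : ω ≤ k * m) (hξ : 0 ≤ ξ) (hd : r ^ 2 ≤ ξ ^ 2 + ω ^ 2) (hY : 2 ≤ Y) (hy : 0 ≤ y)
    (hyY : 1 + y ≤ Y) (hP : r ^ 2 ≤ m ^ 2 + (k * m) ^ 2 + y ^ 2) :
    (6.2832 - r) ^ 2 < (ξ + m) ^ 2 + Y ^ 2 + (r - ω) ^ 2 := by
  have hS := sq_extents_ge (by linarith) h1 h2 hm hω hξ hd
  have hk1 : k ≤ 2 * r - 3.723 :=
    abs_le_of_sq_le_sq' (by nlinarith [sq_nonneg (r - 2.15)]) (by linarith) |>.2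
  have hk1' : k ≤ 1 := by nlinarith
  have base : 0 < r ^ 2 + 12.5664 * r - 35.479 + 2 * r * (1 - k) * 1.56
      + 1.56 ^ 2 * (1 - 2 * k / 3) := by nlinarith
  rcases le_total 1.56 m with hm' | hm'
  · have e1 : 2 * r * (1 - k) * 1.56 ≤ 2 * r * (1 - k) * m := by
      apply mul_le_mul_of_nonneg_left hm'
      have := sub_nonneg.2 hk1'; positivity
    have e2 : 1.56 ^ 2 * (1 - 2 * k / 3) ≤ m ^ 2 * (1 - 2 * k / 3) := by
      apply mul_le_mul_of_nonneg_right _ (by linarith)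
      exact pow_le_pow_left₀ (by norm_num) hm' 2
    have hY2 : 2 ^ 2 ≤ Y ^ 2 := pow_le_pow_left₀ (by norm_num) hY 2
    linarith
  · obtain ⟨T, hT⟩ : ∃ T, T = r ^ 2 - (1 + k ^ 2) * m ^ 2 := ⟨_, rfl⟩
    have hT0 : 1 < r ^ 2 - (1 + k ^ 2) * 1.56 ^ 2 := by rw [hk2]; nlinarith
    have hm1 : 1 ≤ m ^ 2 := one_le_pow₀ hm
    have hm2 : m ^ 2 ≤ 1.56 ^ 2 := pow_le_pow_left₀ (by linarith) hm' 2
    have hk0 : 0 ≤ 1 + k ^ 2 := by positivity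
    have hT1 : 1 < T := by linarith [mul_le_mul_of_nonneg_left hm2 hk0]
    have hT4 : T ≤ 4 := by linarith [mul_le_mul_of_nonneg_left hm1 hk0]
    have hyT : (T + 2) / 3 ≤ y := by
      refine abs_le_of_sq_le_sq' ?_ hy |>.2
      linarith [mul_nonneg (sub_nonneg.2 hT1.le) (sub_nonneg.2 hT4)]
    have hY2 : 7 / 3 + 5 / 3 * T ≤ Y ^ 2 := by
      have := pow_le_pow_left₀ (by linarith) hyY 2
      linarith
    have c0 : 0 ≤ 2 / 3 + 2 * k / 3 + 5 / 3 * k ^ 2 := by positivity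
    have cc := mul_nonneg c0 (mul_nonneg (sub_nonneg.2 hm) (sub_nonneg.2 hm'))
    have at1 : 0 < 8 / 3 * r ^ 2 + 12.5664 * r - 37.1453 + 2 * r * (1 - k)
      - (2 / 3 + 2 * k / 3 + 5 / 3 * k ^ 2) := by
      linarith [mul_le_mul_of_nonneg_left hk1 (by linarith : 0 ≤ 2 * r),
        mul_nonneg (sub_nonneg.2 hr) (sub_nonneg.2 hr')]
    have at2 : 0 < 8 / 3 * r ^ 2 + 12.5664 * r - 37.1453 + 2 * r * (1 - k) * 1.56
      - (2 / 3 + 2 * k / 3 + 5 / 3 * k ^ 2) * 1.56 ^ 2 := by linarith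
    have key : 0 < 8 / 3 * r ^ 2 + 12.5664 * r - 37.1453 + 2 * r * (1 - k) * m
      - (2 / 3 + 2 * k / 3 + 5 / 3 * k ^ 2) * m ^ 2 := by
      rcases le_total 1.2 m with h | h
      · have f1 := mul_le_mul_of_nonneg_left at1.le (sub_nonneg.2 hm')
        have f2 := mul_lt_mul_of_pos_left at2 (by linarith : 0 < m - 1)
        linarith
      · have f2 := mul_le_mul_of_nonneg_left at2.le (sub_nonneg.2 hm)
        have f1 := mul_lt_mul_of_pos_left at1 (by linarith : 0 < 1.56 - m)
        linarith
    linarith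

lemma extents_long {r k ω ξ m Y : ℝ} (hr : 2.35 ≤ r) (hr' : r ≤ 4.1)
    (hk2 : k ^ 2 = r ^ 2 - 2 * r + 0.01) (h1 : 0 ≤ ω) (h2 : ω ≤ 0.6 * r) (hm : 1 ≤ m)
    (hω : ω ≤ k * m) (hξ : 0 ≤ ξ) (hd : r ^ 2 ≤ ξ ^ 2 + ω ^ 2) (hY : 2 * m ≤ Y) :
    (6.2832 - r) ^ 2 < (ξ + m) ^ 2 + Y ^ 2 + (r - ω) ^ 2 := by
  have hS := sq_extents_ge (by linarith) h1 h2 hm hω hξ hd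
  have := extents_long_poly hr hr' hk2 hm
  nlinarith

lemma extents_high {r k ω ξ m Y : ℝ} (hr : 2 ≤ r) (hr' : r ≤ 4.1)
    (hk2 : k ^ 2 = r ^ 2 - 2 * r + 0.01) (h1 : 0.6 * r ≤ ω) (h2 : ω ≤ r) (hm : 1 ≤ m)
    (hω : ω ≤ k * m) (hξ : 0 ≤ ξ) (hd : r ^ 2 ≤ ξ ^ 2 + ω ^ 2) (hY : 2 * m ≤ Y) :
    (6.2832 - r) ^ 2 < (ξ + m) ^ 2 + Y ^ 2 + (r - ω) ^ 2 := by
  have hξ' : 2 * (r - ω) ≤ ξ := abs_le_of_sq_le_sq' (by nlinarith) hξ |>.2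
  have hS : 2 * (r - ω) * (r + 2) + 5 * m ^ 2 ≤ (ξ + m) ^ 2 + Y ^ 2 + (r - ω) ^ 2 := by
    nlinarith
  have p := extents_high_poly hr hr' h1 h2
  have hkm : ω ^ 2 ≤ k ^ 2 * m ^ 2 := by
    rw [← mul_pow]; exact pow_le_pow_left₀ (by linarith) hω 2
  have hk0 : 0 < k ^ 2 := by nlinarith
  rw [← hk2] at p
  refine lt_of_lt_of_le ?_ hS
  refine lt_of_mul_lt_mul_left ?_ hk0.le
  nlinarith

lemma extents_nonneg {r k ω ξ m Y : ℝ} (hr : 2.35 ≤ r) (hr' : r ≤ 6.2832)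
    (hk2 : k ^ 2 = r ^ 2 - 2 * r + 0.01) (h1 : 0 ≤ ω) (h2 : ω ≤ r) (hm : 1 ≤ m)
    (hω : ω ≤ k * m) (hξ : 0 ≤ ξ) (hd : r ^ 2 ≤ ξ ^ 2 + ω ^ 2) (hY : 2 * m ≤ Y) :
    (6.2832 - r) ^ 2 < (ξ + m) ^ 2 + Y ^ 2 + (r - ω) ^ 2 := by
  rcases le_total r 4.1 with h4 | h4
  · rcases le_total (0.6 * r) ω with h6 | h6
    · exact extents_high (by linarith) h4 hk2 h6 h2 hm hω hξ hd hY
    · exact extents_long hr h4 hk2 h1 h6 hm hω hξ hd hY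
  · nlinarith [sq_nonneg (r - ω)]

lemma extents_neg_long {r ω ξ Y : ℝ} (hr : 2.1 ≤ r) (h1 : ω ≤ 0)
    (hξ : 0 ≤ ξ) (hd : r ^ 2 ≤ ξ ^ 2 + ω ^ 2) (hY : 2 ≤ Y) :
    (6.2832 - r) ^ 2 < (ξ + 1) ^ 2 + Y ^ 2 + (r - ω) ^ 2 := by
  have hY2 : 2 ^ 2 ≤ Y ^ 2 := pow_le_pow_left₀ (by norm_num) hY 2
  rcases le_total 0 (r + ω) with h | h
  · have hξ' : r + ω ≤ ξ := by
      refine abs_le_of_sq_le_sq' ?_ hξ |>.2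
      linarith [mul_nonneg (neg_nonneg.2 h1) h]
    linarith [mul_nonneg (neg_nonneg.2 h1) (by linarith : 0 ≤ r - 1),
      pow_le_pow_left₀ (by norm_num) hr 2]
  · linarith [mul_nonneg (neg_nonneg.2 h) (by linarith : 0 ≤ r),
      pow_le_pow_left₀ (by norm_num) hr 2]

lemma extents_neg_short {r ω ξ x w y Y m : ℝ} (hr : 2 ≤ r) (hr' : r ≤ 2.1) (h1 : ω ≤ 0)
    (hξ : 0 ≤ ξ) (hd : r ^ 2 ≤ ξ ^ 2 + ω ^ 2) (hY : 2 ≤ Y) (hm : 1 ≤ m) (hxm : x ≤ m)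
    (hw : ω ≤ w) (hwx : w + 0.314 ≤ x) (hP : r ^ 2 ≤ x ^ 2 + y ^ 2 + w ^ 2) (hy : 0 ≤ y)
    (hyY : 1 + y ≤ Y) :
    (6.2832 - r) ^ 2 < (ξ + m) ^ 2 + Y ^ 2 + (r - ω) ^ 2 := by
  have hY2 : 2 ^ 2 ≤ Y ^ 2 := pow_le_pow_left₀ (by norm_num) hY 2
  have hr2 : (2:ℝ) ^ 2 ≤ r ^ 2 := pow_le_pow_left₀ (by norm_num) hr 2
  have hyY2 := pow_le_pow_left₀ (by linarith) hyY 2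
  have hξm : (ξ + 1) ^ 2 ≤ (ξ + m) ^ 2 := pow_le_pow_left₀ (by linarith) (by linarith) 2
  rcases le_total ω (-0.7) with ha | ha
  · rcases le_total 0 (r + ω) with h | h
    · have hξ' : r + ω ≤ ξ := by
        refine abs_le_of_sq_le_sq' ?_ hξ |>.2
        linarith [mul_nonneg (neg_nonneg.2 h1) h]
      linarith [mul_nonneg (by linarith : 0 ≤ -0.7 - ω) (by linarith : 0 ≤ r - 1)]
    · linarith [mul_nonneg (neg_nonneg.2 h) (by linarith : 0 ≤ r)]
  rcases le_total ω (-0.4) with hb | hb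
  · have hξ' : r + ω / 4 ≤ ξ := by
      refine abs_le_of_sq_le_sq' ?_ hξ |>.2
      linarith [mul_nonneg (neg_nonneg.2 h1) (by linarith : 0 ≤ r / 2 + 17 / 16 * ω)]
    linarith [mul_nonneg (by linarith : 0 ≤ -0.4 - ω) (by linarith : 0 ≤ r - 1)]
  have hω2 : ω ^ 2 ≤ 0.4 ^ 2 := sq_le_sq' (by linarith) (by linarith)
  have hξ' : 1.95 ≤ ξ := abs_le_of_sq_le_sq' (by linarith) hξ |>.2
  rcases le_total 1.36 m with hc | hc
  · have := pow_le_pow_left₀ (by norm_num) (add_le_add hξ' hc) 2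
    linarith [mul_nonneg (neg_nonneg.2 h1) (by linarith : 0 ≤ r), sq_nonneg ω]
  have hξr : r + ω / 4 ≤ ξ := by
    refine abs_le_of_sq_le_sq' ?_ hξ |>.2
    linarith [mul_nonneg (neg_nonneg.2 h1) (by linarith : 0 ≤ r / 2 + 17 / 16 * ω)]
  have hS : 8 + 4 * m + m ^ 2 ≤ (ξ + m) ^ 2 + (r - ω) ^ 2 := by
    linarith [mul_le_mul_of_nonneg_right hξr (by linarith : 0 ≤ m),
      mul_nonneg (neg_nonneg.2 h1) (by linarith : 0 ≤ r - m / 4),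
      mul_le_mul_of_nonneg_right hr (by linarith : 0 ≤ m)]
  have hr3 : (6.2832 - r) ^ 2 ≤ 4.2832 ^ 2 := pow_le_pow_left₀ (by linarith) (by linarith) 2
  rcases le_total x 0 with hx | hx
  · have hx2 : x ^ 2 ≤ 0.1 ^ 2 := sq_le_sq' (by linarith) (by linarith)
    have hw2 : w ^ 2 ≤ 0.4 ^ 2 := sq_le_sq' (by linarith) (by linarith)
    have : 1.9 ≤ y := abs_le_of_sq_le_sq' (by linarith) hy |>.2
    linarith [one_le_pow₀ hm (n := 2)]
  have hx2 : x ^ 2 ≤ m ^ 2 := pow_le_pow_left₀ hx hxm 2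
  have hw2 : w ^ 2 ≤ (m - 0.314) ^ 2 := sq_le_sq' (by linarith) (by linarith)
  have hmm := mul_nonneg (sub_nonneg.2 hm) (sub_nonneg.2 hc)
  have hy1 : 1.02 ≤ y := by
    refine abs_le_of_sq_le_sq' ?_ hy |>.2
    linarith
  linarith

/-- An orthonormal basis of `ℝ³` with prescribed third vector `û` such that a given vector `p` has
vanishing second and nonnegative first coordinate. -/
lemma exists_adapted_basis {û : E3} (hû : ‖û‖ = 1) (p : E3) :
    ∃ e : OrthonormalBasis (Fin 3) ℝ E3, e 2 = û ∧ inner ℝ (e 1) p = 0 ∧ 0 ≤ inner ℝ (e 0) p := by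
  have hcard : Module.finrank ℝ E3 = Fintype.card (Fin 3) := by simp
  have ext : ∀ (v : Fin 3 → E3) (s : Set (Fin 3)), Orthonormal ℝ (s.domRestrict v) →
      ∃ e : OrthonormalBasis (Fin 3) ℝ E3, ∀ i ∈ s, e i = v i := fun v s hv =>
    hv.exists_orthonormalBasis_extension_of_card_eq hcard
  set p' := p - inner ℝ û p • û with hp'
  have hup : inner ℝ û p' = 0 := by
    rw [hp', inner_sub_right, inner_smul_right, real_inner_self_eq_norm_sq, hû]; ring
  have hpe : p = p' + inner ℝ û p • û := by rw [hp']; abel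
  by_cases h0 : p' = 0
  · obtain ⟨e, he⟩ := ext (fun _ => û) {2} ⟨fun _ => hû, fun i j hij =>
      (hij (Subtype.ext (i.2.trans j.2.symm))).elim⟩
    have he2 : e 2 = û := he 2 rfl
    have hz : ∀ i, i ≠ 2 → inner ℝ (e i) p = 0 := by
      intro i hi
      rw [hpe, h0, zero_add, ← he2, inner_smul_right, e.inner_eq_zero hi, mul_zero]
    exact ⟨e, he2, hz 1 (by decide), (hz 0 (by decide)).ge⟩
  · have hn : ‖p'‖ ≠ 0 := norm_ne_zero_iff.2 h0
    have hou : inner ℝ (‖p'‖⁻¹ • p') û = 0 := by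
      rw [inner_smul_left, real_inner_comm, hup, mul_zero]
    obtain ⟨e, he⟩ := ext ![‖p'‖⁻¹ • p', û, û] {0, 2} ⟨by
      rintro ⟨i, rfl | rfl⟩
      · change ‖‖p'‖⁻¹ • p'‖ = 1
        simp [norm_smul, hn]
      · exact hû, by
      rintro ⟨i, rfl | rfl⟩ ⟨j, rfl | rfl⟩ hij
      · exact (hij rfl).elim
      · exact hou
      · rw [real_inner_comm]; exact hou
      · exact (hij rfl).elim⟩
    have he2 : e 2 = û := he 2 (by simp)
    have he0 : e 0 = ‖p'‖⁻¹ • p' := he 0 (by simp)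
    have hp0 : p' = ‖p'‖ • e 0 := by rw [he0, smul_smul, mul_inv_cancel₀ hn, one_smul]
    have hexp : p = ‖p'‖ • e 0 + inner ℝ û p • e 2 := by rw [← hp0, he2]; exact hpe
    refine ⟨e, he2, ?_, ?_⟩
    · rw [hexp, inner_add_right, inner_smul_right, inner_smul_right, e.inner_eq_zero (by decide),
        e.inner_eq_zero (by decide)]; ring
    · rw [hexp, inner_add_right, inner_smul_right, inner_smul_right, e.inner_eq_one,
        e.inner_eq_zero (by decide)]
      simp

namespace MinLoop
variable {L : ℝ} {g : ℝ → E3}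

/-- The rest of a minimal loop after cutting off a spike of height `H`: it closes up at `-û`, its
union with the tip `H • û` inspects the sphere, and its points are at distance at least `H + 1` from
the tip. -/
lemma cut_spike (h : MinLoop L g) {û : E3} (hû : ‖û‖ = 1) {u H : ℝ} (hH : 1 ≤ H)
    (hsp : ∀ τ ∈ Icc 0 (H + 1), g (u + τ) = (H - τ) • û ∧ g (u - τ) = (H - τ) • û) :
    ∃ a b, a ≤ b ∧ b - a = L - 2 * (H + 1) ∧ g a = -û ∧ g b = -û ∧
      Inspects (insert (H • û) (g '' Icc a b)) ∧ ∀ t ∈ Icc a b, H + 1 ≤ ‖g t - H • û‖ := by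
  set r := H + 1 with hr
  have hseg : ∀ s ∈ Icc (u - r) (u + r), ∃ τ ∈ Icc 0 r, g s = (H - τ) • û := by
    intro s hs
    rcases le_total u s with hus | hus
    · exact ⟨s - u, ⟨by linarith, by linarith [hs.2]⟩, by
        rw [← (hsp (s - u) ⟨by linarith, by linarith [hs.2]⟩).1]; congr 1; ring⟩
    · exact ⟨u - s, ⟨by linarith, by linarith [hs.1]⟩, by
        rw [← (hsp (u - s) ⟨by linarith, by linarith [hs.1]⟩).2]; congr 1; ring⟩
  have hend : ∀ y : E3, y = (H - r) • û → y = -û := by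
    rintro y rfl; rw [hr, sub_add_cancel_left, neg_one_smul]
  have ha : g (u + r) = -û := hend _ (hsp r ⟨by linarith, le_rfl⟩).1
  have hb : g (u + L - r) = -û := by
    rw [show u + L - r = (u - r) + L by ring, h.per]
    exact hend _ (hsp r ⟨by linarith, le_rfl⟩).2
  have hL : 2 * r ≤ L := by
    by_contra! hlt
    obtain ⟨e, he, -, -⟩ := exists_adapted_basis hû 0
    obtain ⟨_, ⟨t, rfl⟩, ht⟩ := h.insp (e 0)
    obtain ⟨s, hs, hst⟩ := h.exists_mem_Icc (u - r) t
    obtain ⟨τ, -, hτ⟩ := hseg s ⟨hs.1, by linarith [hs.2]⟩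
    rw [← hst, hτ, ← he, inner_smul_left, e.inner_eq_zero (by decide), e.norm_eq_one] at ht
    simp at ht
    linarith
  have hins : Inspects (insert (H • û) (g '' Icc (u + r) (u + L - r))) := by
    intro v
    obtain ⟨_, ⟨t, rfl⟩, ht⟩ := h.insp v
    obtain ⟨s, hs, hst⟩ := h.exists_mem_Icc (u - r) t
    rw [← hst] at ht
    rcases le_total (u + r) s with h1 | h1
    · exact ⟨g s, Or.inr ⟨s, ⟨h1, by linarith [hs.2]⟩, rfl⟩, ht⟩
    obtain ⟨τ, hτ, hgs⟩ := hseg s ⟨hs.1, h1⟩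
    rw [hgs, real_inner_smul_left] at ht
    rcases le_total 0 (inner ℝ û v) with h2 | h2
    · refine ⟨_, Or.inl rfl, ?_⟩
      rw [real_inner_smul_left]
      nlinarith [hτ.1]
    · refine ⟨_, Or.inr ⟨u + r, ⟨le_rfl, by linarith⟩, rfl⟩, ?_⟩
      rw [ha, inner_neg_left]
      nlinarith [hτ.2]
  refine ⟨u + r, u + L - r, by linarith, by ring, ha, hb, hins, fun t ht => ?_⟩
  have hlip : ∀ S, LipschitzOnWith 1 g S := fun S => h.lip.lipschitzOnWith
  have p1 := pathVia_arc (hlip (Icc t (u + L - r))) ht.2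
  have p2 := pathVia_arc (hlip (Icc (u + r) t)) ht.1
  rw [hb] at p1
  rw [ha] at p2
  have p := ((pathVia_segment (H • û) (g t)).trans (p1.trans p2)).trans
    (pathVia_segment (g t) (H • û))
  have hle := h.le_length _ _ _ p (Inspects.mono hins ?_)
  · rw [norm_sub_rev (H • û)] at hle
    linarith
  rintro _ (rfl | ⟨s, hs, rfl⟩)
  · exact Or.inl (Or.inl (Or.inl rfl))
  rcases le_total s t with hst | hst
  · exact Or.inl (Or.inr (Or.inr ⟨s, ⟨hs.1, hst⟩, rfl⟩))
  · exact Or.inl (Or.inr (Or.inl ⟨s, ⟨hst, hs.2⟩, rfl⟩))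


/-- A minimal loop has no spikes. -/
lemma no_spike (h : MinLoop L g) {û : E3} (hû : ‖û‖ = 1) {u H : ℝ} (hH : 1 ≤ H)
    (hsp : ∀ τ ∈ Icc 0 (H + 1), g (u + τ) = (H - τ) • û ∧ g (u - τ) = (H - τ) • û) : False := by
  obtain ⟨a, b, hab, hba, ha, hb, hins, hdist⟩ := h.cut_spike hû hH hsp
  have hπ := pi_lt_d4
  have hL := h.length_le
  obtain ⟨s, hs, hmax⟩ := isCompact_Icc.exists_isMaxOn (nonempty_Icc.2 hab)
    (f := fun t => inner ℝ û (g t)) (continuous_const.inner h.lip.continuous).continuousOn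
  obtain ⟨e, he, hY, hX⟩ := exists_adapted_basis hû (g s)
  obtain ⟨X, hXd⟩ : ∃ X : ℝ → ℝ, ∀ t, X t = inner ℝ (e 0) (g t) := ⟨_, fun _ => rfl⟩
  obtain ⟨Y, hYd⟩ : ∃ Y : ℝ → ℝ, ∀ t, Y t = inner ℝ (e 1) (g t) := ⟨_, fun _ => rfl⟩
  obtain ⟨w, hwd⟩ : ∃ w : ℝ → ℝ, ∀ t, w t = H - inner ℝ û (g t) := ⟨_, fun _ => rfl⟩
  obtain ⟨r, hr⟩ : ∃ r, r = H + 1 := ⟨_, rfl⟩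
  rw [← hr] at hba hdist
  have hwmin : ∀ t ∈ Icc a b, w s ≤ w t := fun t ht => by
    rw [hwd, hwd]; linarith [show inner ℝ û (g t) ≤ inner ℝ û (g s) from hmax ht]
  have haI : a ∈ Icc a b := ⟨le_rfl, hab⟩
  have hwa : w a = r := by
    rw [hwd, ha, inner_neg_right, real_inner_self_eq_norm_sq, hû, hr]; ring
  have hωr : w s ≤ r := hwa ▸ hwmin a haI
  rw [← hXd] at hX
  rw [← hYd] at hY
  have hsq : ∀ t ∈ Icc a b, r ^ 2 ≤ X t ^ 2 + Y t ^ 2 + w t ^ 2 := by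
    intro t ht
    have h1 := pow_le_pow_left₀ (by linarith) (hdist t ht) 2
    rw [← e.sum_sq_inner_right, Fin.sum_univ_three] at h1
    simp only [inner_sub_right, inner_smul_right, he] at h1
    rw [← he, e.inner_eq_zero (by decide), e.inner_eq_zero (by decide), e.inner_eq_one, he,
      ← hXd, ← hYd] at h1
    rw [hwd]
    linarith
  have hsupp : ∀ α β c N : ℝ, 0 ≤ N → N ^ 2 ≤ α ^ 2 + β ^ 2 + c ^ 2 → H * c < N →
      ∃ t ∈ Icc a b, N ≤ α * X t + β * Y t + c * (H - w t) := by
    intro α β c N hN hN2 hlt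
    obtain ⟨p, hp, hle⟩ := hins (α • e 0 + β • e 1 + c • e 2)
    have hv : N ≤ ‖α • e 0 + β • e 1 + c • e 2‖ := by
      refine abs_le_of_sq_le_sq' ?_ (norm_nonneg _) |>.2
      rw [← e.sum_sq_inner_right, Fin.sum_univ_three]
      simp [inner_add_right, inner_smul_right, e.inner_eq_ite]
      exact hN2
    rcases hp with rfl | ⟨t, ht, rfl⟩
    · simp [inner_add_right, inner_smul_right, inner_smul_left, ← he, e.inner_eq_ite] at hle
      linarith
    · refine ⟨t, ht, hv.trans (hle.trans_eq ?_)⟩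
      rw [real_inner_comm, inner_add_left, inner_add_left, real_inner_smul_left,
        real_inner_smul_left, real_inner_smul_left, hXd, hYd, hwd, he]
      ring
  have hext : ∀ t₀ ∈ Icc a b, ∀ s₁ ∈ Icc a b, ∀ t₁ ∈ Icc a b, ∀ A B : ℝ, 0 ≤ A → 0 ≤ B →
      A ≤ X s - X t₀ → B ≤ Y s₁ - Y t₁ → A ^ 2 + B ^ 2 + (r - w s) ^ 2 ≤ (6.2832 - r) ^ 2 := by
    intro t₀ ht₀ s₁ hs₁ t₁ ht₁ A B hA hB hAX hBY
    have := extent_sq_le h.lip hab (ha.trans hb.symm) e ![s, s₁, s] ![t₀, t₁, a]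
      (by intro i; fin_cases i <;> assumption) (by intro i; fin_cases i <;> assumption)
    rw [Fin.sum_univ_three] at this
    simp only [Matrix.cons_val_zero, Matrix.cons_val_one, Matrix.cons_val, ← hXd, ← hYd, he] at this
    have hz : inner ℝ û (g s) - inner ℝ û (g a) = r - w s := by
      rw [← hwa, hwd, hwd]; ring
    rw [hz, hba] at this
    have h1 := pow_le_pow_left₀ hA hAX 2
    have h2 := pow_le_pow_left₀ hB hBY 2
    have h3 : (L - 2 * r) ^ 2 ≤ (2 * (6.2832 - r)) ^ 2 :=
      pow_le_pow_left₀ (by linarith) (by linarith) 2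
    linarith
  have hr2 : 2 ≤ r := by linarith
  have hr' : r ≤ 6.2832 := by linarith
  have hd : r ^ 2 ≤ X s ^ 2 + w s ^ 2 := by have := hsq s hs; rw [hY] at this; linarith
  obtain ⟨t₀, ht₀, hx₀⟩ := hsupp (-1) 0 0 1 (by norm_num) (by norm_num) (by norm_num)
  obtain ⟨s₁, hs₁, hy₁⟩ := hsupp 0 1 0 1 (by norm_num) (by norm_num) (by norm_num)
  obtain ⟨t₁, ht₁, hy₁'⟩ := hsupp 0 (-1) 0 1 (by norm_num) (by norm_num) (by norm_num)
  have hextP : ∀ t ∈ Icc a b, (X s + max 1 (-X t)) ^ 2 + (max 2 (1 + |Y t|)) ^ 2 +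
      (r - w s) ^ 2 ≤ (6.2832 - r) ^ 2 := by
    intro t ht
    obtain ⟨t', ht', hx'⟩ : ∃ t' ∈ Icc a b, max 1 (-X t) ≤ -X t' := by
      rcases le_total 1 (-X t) with h1 | h1
      · exact ⟨t, ht, (max_eq_right h1).le⟩
      · exact ⟨t₀, ht₀, by rw [max_eq_left h1]; linarith⟩
    obtain ⟨s', hs', t'', ht'', hy'⟩ : ∃ s' ∈ Icc a b, ∃ t'' ∈ Icc a b,
        max 2 (1 + |Y t|) ≤ Y s' - Y t'' := by
      rcases le_total 2 (1 + |Y t|) with h1 | h1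
      · rw [max_eq_right h1]
        rcases le_total 0 (Y t) with h2 | h2
        · exact ⟨t, ht, t₁, ht₁, by rw [abs_of_nonneg h2]; linarith⟩
        · exact ⟨s₁, hs₁, t, ht, by rw [abs_of_nonpos h2]; linarith⟩
      · rw [max_eq_left h1]
        exact ⟨s₁, hs₁, t₁, ht₁, by linarith⟩
    have p1 := le_max_left 1 (-X t)
    have p2 := le_max_left 2 (1 + |Y t|)
    exact hext t' ht' s' hs' t'' ht'' _ _ (by linarith) (by linarith) (by linarith) hy'
  rcases lt_or_ge (w s) 0 with hω | hω
  · rcases le_total 2.1 r with h21 | h21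
    · exact (extents_neg_long h21 hω.le hX hd le_rfl).not_ge
        (hext t₀ ht₀ s₁ hs₁ t₁ ht₁ _ _ (by linarith) (by norm_num) (by linarith) (by linarith))
    · obtain ⟨t, ht, hN⟩ := hsupp (-1) 0 1 1.4142 (by norm_num) (by norm_num) (by linarith)
      exact (extents_neg_short (x := -X t) hr2 h21 hω.le hX hd (le_max_left _ _) (le_max_left _ _)
        (le_max_right _ _) (hwmin t ht) (by linarith) (by rw [neg_sq, sq_abs]; exact hsq t ht)
        (abs_nonneg (Y t)) (le_max_right _ _)).not_ge (hextP t ht)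
  obtain ⟨k, hk, hk2⟩ : ∃ k, 0 < k ∧ k ^ 2 = r ^ 2 - 2 * r + 0.01 := by
    have : 0 < r ^ 2 - 2 * r + 0.01 := by nlinarith
    exact ⟨√(r ^ 2 - 2 * r + 0.01), sqrt_pos.2 this, sq_sqrt this.le⟩
  have hdir : ∀ α β : ℝ, α ^ 2 + β ^ 2 = 1 → ∃ t ∈ Icc a b, w t < k * (α * X t + β * Y t) := by
    intro α β hαβ
    have hpos : 0 ≤ k ^ 2 + 1 := by positivity
    have hlt : H < √(k ^ 2 + 1) := lt_sqrt_of_sq_lt (by rw [hk2, hr]; linarith)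
    obtain ⟨t, ht, hle⟩ := hsupp (k * α) (k * β) 1 (√(k ^ 2 + 1)) (sqrt_nonneg _)
      (by rw [sq_sqrt hpos, mul_pow, mul_pow, ← mul_add, hαβ]; linarith) (by linarith)
    exact ⟨t, ht, by linarith⟩
  have hdir' : ∀ α β : ℝ, α ^ 2 + β ^ 2 = 1 →
      ∃ t ∈ Icc a b, max 1 (w s / k) ≤ α * X t + β * Y t := by
    intro α β hαβ
    rcases le_total 1 (w s / k) with h1 | h1
    · rw [max_eq_right h1]
      obtain ⟨t, ht, hlt⟩ := hdir α β hαβ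
      exact ⟨t, ht, (div_le_iff₀' hk).2 ((hwmin t ht).trans hlt.le)⟩
    · rw [max_eq_left h1]
      obtain ⟨t, ht, hlt⟩ := hsupp α β 0 1 (by norm_num) (by linarith) (by norm_num)
      exact ⟨t, ht, by linarith⟩
  have hμ := le_max_left 1 (w s / k)
  have hμk : w s ≤ k * max 1 (w s / k) := (div_le_iff₀' hk).1 (le_max_right _ _)
  have hextμ : (X s + max 1 (w s / k)) ^ 2 + (2 * max 1 (w s / k)) ^ 2 + (r - w s) ^ 2 ≤
      (6.2832 - r) ^ 2 := by
    obtain ⟨t, ht, h1⟩ := hdir' (-1) 0 (by norm_num)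
    obtain ⟨t', ht', h2⟩ := hdir' 0 1 (by norm_num)
    obtain ⟨t'', ht'', h3⟩ := hdir' 0 (-1) (by norm_num)
    exact hext t ht t' ht' t'' ht'' _ _ (by linarith) (by linarith) (by linarith) (by linarith)
  rcases le_total 2.35 r with h235 | h235
  · exact (extents_nonneg h235 hr' hk2 hω hωr hμ hμk hX hd le_rfl).not_ge hextμ
  rcases le_total (0.6 * r) (w s) with h6 | h6
  · exact (extents_high hr2 (by linarith) hk2 h6 hωr hμ hμk hX hd le_rfl).not_ge hextμ
  obtain ⟨t, ht, hlt⟩ := hdir (-1) 0 (by norm_num)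
  have hwt := hwmin t ht
  have hlt' : w t < k * -X t := by linarith
  have hxt : 0 ≤ -X t := by
    by_contra! hneg
    linarith [mul_neg_of_pos_of_neg hk hneg]
  have hwm : w t ≤ k * max 1 (-X t) :=
    hlt'.le.trans (mul_le_mul_of_nonneg_left (le_max_right _ _) hk.le)
  refine (extents_short (y := |Y t|) hr2 h235 hk.le hk2 hω h6 (le_max_left 1 (-X t))
    (hwt.trans hwm) hX hd (le_max_left _ _) (abs_nonneg _) (le_max_right _ _) ?_).not_ge
    (hextP t ht)
  have q1 := pow_le_pow_left₀ hxt (le_max_right 1 (-X t)) 2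
  have q2 := pow_le_pow_left₀ (hω.trans hwt) hwm 2
  rw [sq_abs]
  rw [neg_sq] at q1
  linarith [hsq t ht]

end MinLoop

lemma norm_inv_smul_sub_le {x y : E3} {δ : ℝ} (hδ : 0 < δ) (hx : δ ≤ ‖x‖) (hy : δ ≤ ‖y‖) :
    ‖‖x‖⁻¹ • x - ‖y‖⁻¹ • y‖ ≤ 2 / δ * ‖x - y‖ := by
  have hx0 : 0 < ‖x‖ := hδ.trans_le hx
  have hy0 : 0 < ‖y‖ := hδ.trans_le hy
  have e : ‖x‖⁻¹ • x - ‖y‖⁻¹ • y = ‖x‖⁻¹ • (x - y) + (‖x‖⁻¹ - ‖y‖⁻¹) • y := by module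
  have h1 : ‖‖x‖⁻¹ • (x - y)‖ = ‖x‖⁻¹ * ‖x - y‖ := by
    rw [norm_smul, norm_inv, norm_norm]
  have h2 : ‖(‖x‖⁻¹ - ‖y‖⁻¹) • y‖ = ‖x‖⁻¹ * |‖x‖ - ‖y‖| := by
    rw [norm_smul, norm_eq_abs, inv_sub_inv hx0.ne' hy0.ne', abs_div,
      abs_of_pos (mul_pos hx0 hy0), abs_sub_comm]
    field_simp
  have h3 : ‖x‖⁻¹ ≤ δ⁻¹ := inv_anti₀ hδ hx
  rw [e]
  calc _ ≤ ‖x‖⁻¹ * ‖x - y‖ + ‖x‖⁻¹ * ‖x - y‖ := by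
        refine (norm_add_le _ _).trans (add_le_add h1.le (h2.le.trans ?_))
        exact mul_le_mul_of_nonneg_left (abs_norm_sub_norm_le x y) (by positivity)
    _ ≤ δ⁻¹ * ‖x - y‖ + δ⁻¹ * ‖x - y‖ := by gcongr
    _ = _ := by ring

lemma lipschitzOnWith_inv_norm_smul {g : ℝ → E3} (hg : LipschitzWith 1 g) {δ : ℝ} (hδ : 0 < δ)
    {S : Set ℝ} (hS : ∀ s ∈ S, δ ≤ ‖g s‖) :
    LipschitzOnWith (2 / δ).toNNReal (fun s => ‖g s‖⁻¹ • g s) S := by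
  refine LipschitzOnWith.of_dist_le_mul fun x hx y hy => ?_
  rw [Real.coe_toNNReal _ (by positivity), dist_eq_norm]
  refine (norm_inv_smul_sub_le hδ (hS x hx) (hS y hy)).trans ?_
  gcongr
  simpa [dist_eq_norm] using hg.dist_le_mul x y

namespace MinLoop
variable {L : ℝ} {g : ℝ → E3}

lemma straight_at_zero (h : MinLoop L g) {t : ℝ} (ht : g t = 0) :
    ∃ ε > 0, ∃ w, ‖w‖ = 1 ∧ ∀ s ∈ Icc (t - ε) (t + ε), g s = (s - t) • w := by
  obtain ⟨ε, hε, w, hw, hs⟩ := h.locally_straight (t := t)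
    (h.inner_of_norm_lt (by rw [ht, norm_zero]; exact one_pos))
  refine ⟨ε, hε, w, hw, fun s hs' => ?_⟩
  have := hs (s - t) ⟨by linarith [hs'.1], by linarith [hs'.2]⟩
  rwa [add_sub_cancel, ht, zero_add] at this

/-- Where the loop runs along a line through the origin, its radial projection is locally
constant away from the origin. -/
lemma deriv_proj_eq_zero {t ε : ℝ} {w : E3} (hw : ‖w‖ = 1)
    (hs : ∀ s ∈ Icc (t - ε) (t + ε), g s = (s - t) • w) {s : ℝ} (hst : s ∈ Ioo (t - ε) (t + ε))
    (hne : s ≠ t) : deriv (fun s => ‖g s‖⁻¹ • g s) s = 0 := by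
  have hev : (fun s => ‖g s‖⁻¹ • g s) =ᶠ[nhds s] fun _ => (SignType.sign (s - t) : ℝ) • w := by
    rcases lt_or_gt_of_ne hne with hlt | hlt
    · filter_upwards [Ioo_mem_nhds hst.1 hst.2, Iio_mem_nhds hlt] with x hx hxt
      have : x - t < 0 := sub_neg.2 hxt
      rw [hs x (Ioo_subset_Icc_self hx), norm_smul, hw, mul_one, norm_eq_abs, abs_of_neg this,
        smul_smul, sign_neg (sub_neg.2 hlt), inv_neg, neg_mul, inv_mul_cancel₀ this.ne]
      simp
    · filter_upwards [Ioo_mem_nhds hst.1 hst.2, Ioi_mem_nhds hlt] with x hx hxt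
      have : 0 < x - t := sub_pos.2 hxt
      rw [hs x (Ioo_subset_Icc_self hx), norm_smul, hw, mul_one, norm_eq_abs, abs_of_pos this,
        smul_smul, sign_pos (sub_pos.2 hlt), inv_mul_cancel₀ this.ne']
      simp
  rw [hev.deriv_eq, deriv_const]

lemma locallyIntegrable_deriv_proj (h : MinLoop L g) :
    LocallyIntegrable (fun s => ‖deriv (fun s => ‖g s‖⁻¹ • g s) s‖) := by
  intro t
  have hm : Measurable fun s => ‖deriv (fun s => ‖g s‖⁻¹ • g s) s‖ := (measurable_deriv _).norm
  refine Measure.FiniteAtFilter.integrableAtFilter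
    ⟨univ, Filter.univ_mem, hm.aestronglyMeasurable⟩ (volume.finiteAt_nhds t) ?_
  by_cases ht : g t = 0
  · obtain ⟨ε, hε, w, hw, hs⟩ := h.straight_at_zero ht
    refine ⟨‖deriv (fun s => ‖g s‖⁻¹ • g s) t‖, Filter.eventually_map.2 ?_⟩
    filter_upwards [Ioo_mem_nhds (by linarith : t - ε < t) (by linarith : t < t + ε)] with s hst
    rcases eq_or_ne s t with rfl | hne
    · simp
    · simp [deriv_proj_eq_zero hw hs hst hne]
  · have hpos : 0 < ‖g t‖ := norm_pos_iff.2 ht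
    have hopen : IsOpen {s | ‖g t‖ / 2 < ‖g s‖} :=
      isOpen_lt continuous_const h.lip.continuous.norm
    have hlip := lipschitzOnWith_inv_norm_smul h.lip (half_pos hpos)
      (S := {s | ‖g t‖ / 2 < ‖g s‖}) fun s hs => le_of_lt hs
    refine ⟨(2 / (‖g t‖ / 2)).toNNReal, Filter.eventually_map.2 ?_⟩
    filter_upwards [hopen.mem_nhds (show ‖g t‖ / 2 < ‖g t‖ by linarith)] with s hs
    rw [Function.comp_apply, norm_norm]
    exact norm_deriv_le_of_lipschitzOn (hopen.mem_nhds hs) hlip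

lemma intervalIntegrable_deriv_proj (h : MinLoop L g) (a b : ℝ) :
    IntervalIntegrable (fun s => ‖deriv (fun s => ‖g s‖⁻¹ • g s) s‖) volume a b :=
  (h.locallyIntegrable_deriv_proj.integrableOn_isCompact isCompact_uIcc).intervalIntegrable

lemma proj_eq_of_integral_eq_zero (h : MinLoop L g) {a b : ℝ} (hab : a ≤ b)
    (h0 : ∀ s ∈ Icc a b, g s ≠ 0)
    (hInt : ∫ s in a..b, ‖deriv (fun s => ‖g s‖⁻¹ • g s) s‖ = 0) :
    ∀ s ∈ Icc a b, ‖g s‖⁻¹ • g s = ‖g a‖⁻¹ • g a := by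
  obtain ⟨c, hc, hmin⟩ := isCompact_Icc.exists_isMinOn (nonempty_Icc.2 hab)
    h.lip.continuous.norm.continuousOn
  have hlip := lipschitzOnWith_inv_norm_smul h.lip (norm_pos_iff.2 (h0 c hc)) (S := Icc a b) hmin
  rw [intervalIntegral.integral_eq_zero_iff_of_le_of_nonneg_ae hab
    (Filter.Eventually.of_forall fun _ => norm_nonneg _) (h.intervalIntegrable_deriv_proj a b),
    Filter.EventuallyEq, ae_restrict_iff' measurableSet_Ioc] at hInt
  have hae : ∀ x : ℝ, ∀ᵐ s : ℝ, s ≠ x := fun x => by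
    simp [ae_iff]
  obtain ⟨C, hC⟩ := AbsolutelyContinuousOnInterval.const_of_ae_hasDerivAt_zero (a := a) (b := b)
    (LipschitzOnWith.absolutelyContinuousOnInterval (by rwa [uIcc_of_le hab])) (by
      filter_upwards [hInt, hlip.ae_differentiableWithinAt_of_mem_real, hae a, hae b]
        with s hs hd hsa hsb hsI
      rw [uIcc_of_le hab] at hsI
      have h1 : a < s := lt_of_le_of_ne hsI.1 hsa.symm
      have h2 : s < b := lt_of_le_of_ne hsI.2 hsb
      have := ((hd hsI).differentiableAt (Icc_mem_nhds h1 h2)).hasDerivAt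
      rwa [norm_eq_zero.1 (hs ⟨h1, hsI.2⟩)] at this)
  rw [uIcc_of_le hab] at hC
  intro s hs
  exact (hC s hs).trans (hC a ⟨le_rfl, hab⟩).symm

/-- A minimal loop does not return to the same point along a stretch on which its radial
projection does not move. -/
lemma norm_ne_of_integral_eq_zero (h : MinLoop L g) {a b : ℝ} (hab : a < b) (hbL : b ≤ a + L)
    (h0 : ∀ s ∈ Icc a b, g s ≠ 0)
    (hInt : ∫ s in a..b, ‖deriv (fun s => ‖g s‖⁻¹ • g s) s‖ = 0) : ‖g a‖ ≠ ‖g b‖ := by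
  intro hn
  have hproj := h.proj_eq_of_integral_eq_zero hab.le h0 hInt
  have hray : ∀ t ∈ Icc a b, g t = ‖g t‖ • (‖g a‖⁻¹ • g a) := fun t ht => by
    rw [← hproj t ht, smul_smul, mul_inv_cancel₀ (norm_ne_zero_iff.2 (h0 t ht)), one_smul]
  have hû : ‖‖g a‖⁻¹ • g a‖ = 1 := by
    rw [norm_smul, norm_inv, norm_norm,
      inv_mul_cancel₀ (norm_ne_zero_iff.2 (h0 a ⟨le_rfl, hab.le⟩))]
  have hgab : g a = g b := by
    rw [hray a ⟨le_rfl, hab.le⟩, hray b ⟨hab.le, le_rfl⟩, hn]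
  obtain ⟨u, H, hH, hsp⟩ := h.exists_spike hab hbL hû hray hgab
  exact h.no_spike hû hH hsp

end MinLoop

section Subdivision
variable {L : ℝ} {m : ℕ} {tk : ℕ → ℝ} {g : ℝ → E3}

lemma le_subdivision_succ (hmono : StrictMonoOn tk (Iic m)) (h0 : tk 0 = 0) (hm : tk m = L)
    (hz : ∀ s ∈ Ioo (0 : ℝ) L, (g s = 0 ↔ ∃ k : ℕ, 0 < k ∧ k < m ∧ s = tk k)) {j : ℕ} (hj : j < m)
    {s : ℝ} (hs : s ≤ L)
    (hne : tk j < tk (j + 1) → tk (j + 1) < s → g (tk (j + 1)) ≠ 0) :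
    s ≤ tk (j + 1) := by
  by_contra! hlt
  have hlt' : tk j < tk (j + 1) := hmono hj.le hj (Nat.lt_succ_self j)
  rcases (Nat.succ_le_of_lt hj).eq_or_lt with he | hl
  · rw [show j + 1 = m from he, hm] at hlt
    exact absurd hs hlt.not_ge
  · have h1 : 0 < tk (j + 1) := h0 ▸ hmono (Nat.zero_le m) hl.le (Nat.succ_pos j)
    have h2 : tk (j + 1) < L := hm ▸ hmono hl.le (le_refl m) hl
    exact hne hlt' hlt ((hz _ ⟨h1, h2⟩).2 ⟨j + 1, Nat.succ_pos j, hl, rfl⟩)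

lemma subdivision_pred_le (hmono : StrictMonoOn tk (Iic m)) (h0 : tk 0 = 0) (hm : tk m = L)
    (hz : ∀ s ∈ Ioo (0 : ℝ) L, (g s = 0 ↔ ∃ k : ℕ, 0 < k ∧ k < m ∧ s = tk k)) {j : ℕ} (hj : 0 < j)
    (hjm : j ≤ m) {s : ℝ} (hs : 0 ≤ s)
    (hne : s < tk (j - 1) → tk (j - 1) < tk j → g (tk (j - 1)) ≠ 0) :
    tk (j - 1) ≤ s := by
  by_contra! hlt
  have hj1 : j - 1 < m := by omega
  have hlt' : tk (j - 1) < tk j := hmono hj1.le hjm (Nat.sub_lt hj one_pos)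
  rcases Nat.eq_zero_or_pos (j - 1) with he | hl
  · rw [he, h0] at hlt
    exact absurd hs hlt.not_ge
  · have h1 : 0 < tk (j - 1) := h0 ▸ hmono (Nat.zero_le m) hj1.le hl
    have h2 : tk (j - 1) < L := hm ▸ hmono hj1.le (le_refl m) hj1
    exact hne hlt hlt' ((hz _ ⟨h1, h2⟩).2 ⟨j - 1, hl, hj1, rfl⟩)

lemma exists_subdivision_index (hmono : StrictMonoOn tk (Iic m)) (hmpos : 0 < m) (h0 : tk 0 = 0)
    (hm : tk m = L) {t : ℝ} (ht : t ∈ Icc 0 L) :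
    ∃ k, 1 ≤ k ∧ k ≤ m ∧ t ∈ Icc (tk (k - 1)) (tk k) := by
  classical
  have hex : ∃ k, t ≤ tk k := ⟨m, hm ▸ ht.2⟩
  have hle : Nat.find hex ≤ m := Nat.find_min' hex (hm ▸ ht.2)
  rcases Nat.eq_zero_or_pos (Nat.find hex) with hk | hk
  · have h1 := Nat.find_spec hex
    rw [hk] at h1
    exact ⟨1, le_rfl, hmpos, h0.le.trans ht.1, h1.trans (hmono (Nat.zero_le m) hmpos one_pos).le⟩
  · exact ⟨Nat.find hex, hk, hle,
      (not_le.1 (Nat.find_min hex (Nat.sub_lt hk one_pos))).le, Nat.find_spec hex⟩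

end Subdivision

/-- Near a zero of the curve the unfolding is a straight segment through the origin. -/
lemma unfolding_injOn_of_eq_zero {L : ℝ} {γ : AddCircle L → E3} (h : MinLoop L (liftCurve L γ))
    {γt : ℝ → ℂ} (hunf : IsUnfolding L γ γt) {t : ℝ} (ht : t ∈ Icc 0 L)
    (hgt : liftCurve L γ t = 0) : ∃ U ∈ nhdsWithin t (Icc 0 L), InjOn γt U := by
  obtain ⟨m, tk, hmpos, hmono, h0, hm, hz, hform⟩ := hunf
  obtain ⟨ε, hε, w, hw, hs⟩ := h.straight_at_zero hgt
  have hj : ∃ j ≤ m, t = tk j := by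
    rcases ht.1.eq_or_lt with rfl | h1
    · exact ⟨0, hmpos.le, h0.symm⟩
    rcases ht.2.eq_or_lt with rfl | h2
    · exact ⟨m, le_rfl, hm.symm⟩
    obtain ⟨k, -, hk, rfl⟩ := (hz t ⟨h1, h2⟩).1 hgt
    exact ⟨k, hk.le, rfl⟩
  obtain ⟨j, hjm, hj⟩ := hj
  have hne : ∀ x ∈ Icc (t - ε) (t + ε), x ≠ t → liftCurve L γ x ≠ 0 := fun x hx hxt => by
    rw [hs x hx]
    exact smul_ne_zero (sub_ne_zero.2 hxt) (norm_ne_zero_iff.1 (by rw [hw]; exact one_ne_zero))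
  have hnorm : ∀ s ∈ Icc (t - ε) (t + ε), ‖liftCurve L γ s‖ = |s - t| := fun s hst => by
    rw [hs s hst, norm_smul, hw, mul_one, norm_eq_abs]
  have hθ : ∀ s ∈ Ioo (t - ε) (t + ε), thetaFn L γ s = thetaFn L γ t := by
    intro s hst
    have hd : thetaFn L γ s - thetaFn L γ t = ∫ u in t..s, ‖projDeriv L γ u‖ :=
      intervalIntegral.integral_interval_sub_left (h.intervalIntegrable_deriv_proj 0 s)
        (h.intervalIntegrable_deriv_proj 0 t)
    have hzero : ∫ u in t..s, ‖projDeriv L γ u‖ = ∫ u in t..s, (0 : ℝ) := by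
      refine intervalIntegral.integral_congr_ae ?_
      have : ∀ᵐ u : ℝ, u ≠ t := by simp [ae_iff]
      filter_upwards [this] with u hut hu
      have hu' : u ∈ Ioo (t - ε) (t + ε) := by
        have := uIoc_subset_uIcc hu
        exact (ordConnected_Ioo.uIcc_subset ⟨by linarith, by linarith⟩ hst) this
      exact norm_eq_zero.2 (MinLoop.deriv_proj_eq_zero hw hs hu' hut)
    rw [hzero, intervalIntegral.integral_zero] at hd
    linarith
  refine ⟨Ioo (t - ε) (t + ε) ∩ Icc 0 L, Filter.inter_mem (mem_nhdsWithin_of_mem_nhds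
    (Ioo_mem_nhds (by linarith) (by linarith))) self_mem_nhdsWithin, ?_⟩
  have hlin : ∀ s ∈ Ioo (t - ε) (t + ε) ∩ Icc 0 L, γt s = ((s - t : ℝ) : ℂ) *
      Complex.exp (Complex.I * Complex.ofReal (thetaFn L γ t + j * π)) := by
    rintro s ⟨hst, hsL⟩
    have hsc := Ioo_subset_Icc_self hst
    have hleft : 0 < j → s ≤ t → γt s = ((s - t : ℝ) : ℂ) *
        Complex.exp (Complex.I * Complex.ofReal (thetaFn L γ t + j * π)) := by
      intro hj0 hle
      have hsk : tk (j - 1) ≤ s := subdivision_pred_le hmono h0 hm hz hj0 hjm hsL.1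
        fun h1 h2 => hne _ ⟨hsc.1.trans h1.le, by linarith⟩ (by rw [hj]; exact h2.ne)
      rw [hform j hj0 hjm s ⟨hsk, hj ▸ hle⟩, hnorm s hsc, hθ s hst, abs_of_nonpos (by linarith),
        show thetaFn L γ t + (j : ℝ) * π = thetaFn L γ t + ((j : ℝ) - 1) * π + π by ring,
        Complex.ofReal_add _ π, mul_add, Complex.exp_add, mul_comm Complex.I (π : ℂ),
        Complex.exp_pi_mul_I]
      push_cast
      ring
    have hright : j < m → t ≤ s → γt s = ((s - t : ℝ) : ℂ) *
        Complex.exp (Complex.I * Complex.ofReal (thetaFn L γ t + j * π)) := by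
      intro hjm' hle
      have hsk : s ≤ tk (j + 1) := le_subdivision_succ hmono h0 hm hz hjm' hsL.2
        fun h1 h2 => hne _ ⟨by linarith, h2.le.trans hsc.2⟩ (by rw [hj]; exact h1.ne')
      have := hform (j + 1) (Nat.succ_pos j) hjm' s
        ⟨by rw [Nat.add_sub_cancel, ← hj]; exact hle, hsk⟩
      rw [this, hnorm s hsc, hθ s hst, abs_of_nonneg (by linarith)]
      push_cast
      ring_nf
    rcases Nat.eq_zero_or_pos j with hj0 | hj0
    · exact hright (hj0 ▸ hmpos) (by rw [hj, hj0, h0]; exact hsL.1)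
    rcases hjm.eq_or_lt with hjm' | hjm'
    · exact hleft hj0 (by rw [hj, hjm', hm]; exact hsL.2)
    · exact (le_total s t).elim (hleft hj0) (hright hjm')
  intro x hx y hy hxy
  rw [hlin x hx, hlin y hy] at hxy
  have := mul_right_cancel₀ (Complex.exp_ne_zero _) hxy
  have := Complex.ofReal_injective this
  linarith

lemma unfolding_injOn_of_ne_zero {L : ℝ} {γ : AddCircle L → E3} (h : MinLoop L (liftCurve L γ))
    {γt : ℝ → ℂ} (hunf : IsUnfolding L γ γt) {t : ℝ} (ht : t ∈ Icc 0 L)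
    (hgt : liftCurve L γ t ≠ 0) : ∃ U ∈ nhdsWithin t (Icc 0 L), InjOn γt U := by
  obtain ⟨m, tk, hmpos, hmono, h0, hm, hz, hform⟩ := hunf
  have hθc : Continuous (thetaFn L γ) :=
    intervalIntegral.continuous_primitive h.intervalIntegrable_deriv_proj 0
  obtain ⟨ε, hε, hball⟩ := Metric.eventually_nhds_iff.1
    ((h.lip.continuous.continuousAt.eventually_ne hgt).and
      (hθc.continuousAt.eventually (Metric.ball_mem_nhds (thetaFn L γ t) pi_pos)))
  have hnear : ∀ s ∈ Ioo (t - ε) (t + ε), liftCurve L γ s ≠ 0 ∧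
      |thetaFn L γ s - thetaFn L γ t| < π := fun s hs =>
    hball (by rw [Real.dist_eq, abs_sub_lt_iff]; constructor <;> linarith [hs.1, hs.2])
  obtain ⟨k, hk1, hkm, htk⟩ := exists_subdivision_index hmono hmpos h0 hm ht
  refine ⟨Ioo (t - ε) (t + ε) ∩ Icc 0 L, Filter.inter_mem (mem_nhdsWithin_of_mem_nhds
    (Ioo_mem_nhds (by linarith) (by linarith))) self_mem_nhdsWithin, ?_⟩
  have hsub : ∀ s ∈ Ioo (t - ε) (t + ε) ∩ Icc 0 L, s ∈ Icc (tk (k - 1)) (tk k) := by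
    rintro s ⟨hs, hsL⟩
    constructor
    · exact subdivision_pred_le hmono h0 hm hz hk1 hkm hsL.1 fun h1 _ =>
        (hnear _ ⟨hs.1.trans h1, by linarith [htk.1]⟩).1
    · have := le_subdivision_succ hmono h0 hm hz (j := k - 1) (by omega) hsL.2
      rw [Nat.sub_add_cancel hk1] at this
      exact this fun _ h2 => (hnear _ ⟨by linarith [htk.2], h2.trans hs.2⟩).1
  have key : ∀ x ∈ Ioo (t - ε) (t + ε) ∩ Icc 0 L, ∀ y ∈ Ioo (t - ε) (t + ε) ∩ Icc 0 L,
      x < y → γt x ≠ γt y := by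
    intro x hx y hy hxy heq
    rw [hform k hk1 hkm x (hsub x hx), hform k hk1 hkm y (hsub y hy)] at heq
    have hn : ‖liftCurve L γ x‖ = ‖liftCurve L γ y‖ := by
      have := congrArg norm heq
      simpa only [norm_mul, Complex.norm_exp_I_mul_ofReal, mul_one, Complex.norm_real,
        norm_norm] using this
    rw [hn] at heq
    have heq' := mul_left_cancel₀
      (Complex.ofReal_ne_zero.2 (norm_ne_zero_iff.2 (hnear y hy.1).1)) heq
    obtain ⟨n, hn'⟩ := Complex.exp_eq_exp_iff_exists_int.1 heq'
    have hre : thetaFn L γ x - thetaFn L γ y = n * (2 * π) := by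
      have := congrArg Complex.im hn'
      simp at this
      linarith
    have hlt : |thetaFn L γ x - thetaFn L γ y| < 2 * π := by
      have h1 := abs_lt.1 (hnear x hx.1).2
      have h2 := abs_lt.1 (hnear y hy.1).2
      rw [abs_lt]
      constructor <;> linarith
    have hn0 : n = 0 := by
      rw [hre, abs_mul, abs_of_pos two_pi_pos] at hlt
      have : |(n : ℝ)| < 1 := by
        by_contra! hge
        linarith [mul_le_mul_of_nonneg_right hge two_pi_pos.le]
      exact Int.abs_lt_one_iff.1 (by exact_mod_cast this)
    rw [hn0, Int.cast_zero, zero_mul] at hre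
    have hInt : ∫ u in x..y, ‖projDeriv L γ u‖ = 0 := by
      have : thetaFn L γ y - thetaFn L γ x = ∫ u in x..y, ‖projDeriv L γ u‖ :=
        intervalIntegral.integral_interval_sub_left (h.intervalIntegrable_deriv_proj 0 y)
          (h.intervalIntegrable_deriv_proj 0 x)
      linarith
    exact h.norm_ne_of_integral_eq_zero hxy (by linarith [hx.2.1, hy.2.2])
      (fun s hs => (hnear s ⟨hx.1.1.trans_le hs.1, hs.2.trans_lt hy.1.2⟩).1) hInt hn
  intro x hx y hy hxy
  rcases lt_trichotomy x y with hlt | rfl | hlt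
  · exact (key x hx y hy hlt hxy).elim
  · rfl
  · exact (key y hy x hx hlt hxy.symm).elim

/-- The unfolding `γt` of a minimal inspection curve `γ` (parameterized
so that `0` is a local minimum point of `|γ|`) is locally one-to-one on `[0, L]`. -/
theorem unfolding_locally_injective
    (L : ℝ) (γ : AddCircle L → E3) (hγ : IsMinInspectionCurve L γ)
    (h0 : IsLocalMin (fun s : ℝ => ‖liftCurve L γ s‖) 0)
    (γt : ℝ → ℂ) (hunf : IsUnfolding L γ γt) :
    ∀ t ∈ Set.Icc (0:ℝ) L, ∃ U ∈ nhdsWithin t (Set.Icc (0:ℝ) L), Set.InjOn γt U := by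
  have h := hγ.minLoop
  intro t ht
  by_cases hgt : liftCurve L γ t = 0
  · exact unfolding_injOn_of_eq_zero h hunf ht hgt
  · exact unfolding_injOn_of_ne_zero h hunf ht hgt
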